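/- arXiv:1304.0201 — 2 statements merged into one kernel-verified Lean document; each statement's English description precedes it below -/
import Mathlib

section
/- Let $F_1, F_2$ be formally real fields containing $\R$, linearly disjoint over $\R$ inside a common extension, and let $F$ be their compositum. Then the projection map $\rho: M(F) \to M(F_1) \times M(F_2)$, $\rho(\xi) = (\xi|_{F_1}, \xi|_{F_2})$, is surjective: for any $\R$-places $\xi_1$ of $F_1$ and $\xi_2$ of $F_2$ there is an $\R$-place $\xi$ of $F$ restricting to $\xi_1$ on $F_1$ and to $\xi_2$ on $F_2$. -/
open Set

section Places
open scoped Classical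

/-- A place of the field `L` with values in the field `K` (together with `∞ = ⊤`):
it maps `1` to `1`, is additive and multiplicative on elements with finite value, and
elements with value `∞` are nonzero with inverse of value `0`. -/
def IsPlaceFun {L K : Type*} [Field L] [Field K] (f : L → WithTop K) : Prop :=
  f 1 = 1 ∧
  (∀ x y : L, f x ≠ ⊤ → f y ≠ ⊤ → f (x + y) = f x + f y) ∧
  (∀ x y : L, f x ≠ ⊤ → f y ≠ ⊤ → f (x * y) = f x * f y) ∧
  ∀ x : L, f x = ⊤ → x ≠ 0 ∧ f x⁻¹ = 0

/-- Composition of places: `ζ ∘ ξ`, with `ζ(∞) = ∞`. -/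
def placeComp {L K : Type*} [Field L] [Field K] (zeta : K → WithTop ℝ)
    (xi : L → WithTop K) : L → WithTop ℝ :=
  fun x => WithTop.recTopCoe ⊤ zeta (xi x)

/-- The space `M(K)` of `ℝ`-places of `K`: places `K → ℝ ∪ {∞}`. -/
def RPlaces (K : Type*) [Field K] : Type _ := {f : K → WithTop ℝ // IsPlaceFun f}

/-- The subbasic open set `H'(b) = {ζ ∈ M(K) | ∞ ≠ ζ(b) > 0}`. -/
def Hpos {K : Type*} [Field K] (b : K) : Set (RPlaces K) :=
  {zeta : RPlaces K | ∃ r : ℝ, 0 < r ∧ zeta.1 b = (r : WithTop ℝ)}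

/-- The topology on `M(K)` generated by the subbasic sets `H'(b)`, `b ∈ K`. -/
instance (K : Type*) [Field K] : TopologicalSpace (RPlaces K) :=
  TopologicalSpace.generateFrom {U | ∃ b : K, U = Hpos b}

end Places


section Helpers
open scoped Classical

theorem place_zero {L K : Type*} [Field L] [Field K] {f : L → WithTop K}
    (hf : IsPlaceFun f) : f 0 = 0 := by
  obtain ⟨h1, ha, hm, hi⟩ := hf
  have h0 : f 0 ≠ ⊤ := fun h => (hi 0 h).1 rfl
  have := ha 0 0 h0 h0
  rw [add_zero] at this
  obtain ⟨r, hr⟩ := WithTop.ne_top_iff_exists.1 h0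
  rw [← hr] at this ⊢
  have h2 : r = r + r := by exact_mod_cast this
  have : r = 0 := by simpa using h2
  simp [this]

theorem place_neg {L K : Type*} [Field L] [Field K] {f : L → WithTop K}
    (hf : IsPlaceFun f) {x : L} (hx : f x ≠ ⊤) : f (-x) ≠ ⊤ := by
  intro h
  obtain ⟨h1, ha, hm, hi⟩ := id hf
  have hinv := (hi _ h).2
  -- f (-x)⁻¹ = 0, so f ((-x)⁻¹ * x) = 0
  have h3 := hm (-x)⁻¹ x (by rw [hinv]; exact WithTop.zero_ne_top) hx
  have hx0 : x ≠ 0 := by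
    have := (hi _ h).1
    simpa using this
  obtain ⟨r, hr⟩ := WithTop.ne_top_iff_exists.1 hx
  have h4 : (-x)⁻¹ * x = -1 := by field_simp
  rw [h4, hinv, zero_mul] at h3
  have h5 := hm (-1) (-1) (by rw [h3]; exact WithTop.zero_ne_top)
    (by rw [h3]; exact WithTop.zero_ne_top)
  rw [h3] at h5
  simp [h1] at h5

/-- The valuation subring of a place. -/
def placeRing {L K : Type*} [Field L] [Field K] {f : L → WithTop K}
    (hf : IsPlaceFun f) : ValuationSubring L where
  carrier := {x | f x ≠ ⊤}
  zero_mem' := by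
    change f 0 ≠ ⊤
    rw [place_zero hf]; exact WithTop.zero_ne_top
  one_mem' := by
    change f 1 ≠ ⊤
    rw [hf.1]; exact WithTop.one_ne_top
  add_mem' := by
    intro a b ha hb
    change f (a + b) ≠ ⊤
    rw [hf.2.1 a b ha hb]
    exact WithTop.add_ne_top.2 ⟨ha, hb⟩
  mul_mem' := by
    intro a b ha hb
    change f (a * b) ≠ ⊤
    rw [hf.2.2.1 a b ha hb]
    obtain ⟨r, hr⟩ := WithTop.ne_top_iff_exists.1 ha
    obtain ⟨s, hs⟩ := WithTop.ne_top_iff_exists.1 hb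
    rw [← hr, ← hs, ← WithTop.coe_mul]
    exact WithTop.coe_ne_top
  neg_mem' := by
    intro a ha
    exact place_neg hf ha
  mem_or_inv_mem' := by
    intro x
    by_cases h : f x = ⊤
    · right
      change f x⁻¹ ≠ ⊤
      rw [(hf.2.2.2 x h).2]; exact WithTop.zero_ne_top
    · left; exact h

theorem mem_placeRing {L K : Type*} [Field L] [Field K] {f : L → WithTop K}
    (hf : IsPlaceFun f) (x : L) : x ∈ placeRing hf ↔ f x ≠ ⊤ := Iff.rfl

/-- The residue map. -/
noncomputable def placeRes {L K : Type*} [Field L] [Field K] {f : L → WithTop K}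
    (hf : IsPlaceFun f) : placeRing hf →+* K where
  toFun x := (f x.1).untop ((mem_placeRing hf x.1).1 x.2)
  map_one' := by
    apply WithTop.coe_injective
    rw [WithTop.coe_untop]; exact hf.1
  map_zero' := by
    apply WithTop.coe_injective
    rw [WithTop.coe_untop]; exact place_zero hf
  map_add' := by
    intro x y
    apply WithTop.coe_injective
    rw [WithTop.coe_untop, WithTop.coe_add, WithTop.coe_untop, WithTop.coe_untop]
    exact hf.2.1 _ _ x.2 y.2
  map_mul' := by
    intro x y
    apply WithTop.coe_injective
    rw [WithTop.coe_untop, WithTop.coe_mul, WithTop.coe_untop, WithTop.coe_untop]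
    exact hf.2.2.1 _ _ x.2 y.2

theorem coe_placeRes {L K : Type*} [Field L] [Field K] {f : L → WithTop K}
    (hf : IsPlaceFun f) (x : placeRing hf) : ((placeRes hf x : K) : WithTop K) = f x.1 :=
  WithTop.coe_untop _ _

theorem place_real_finite {L : Type*} [Field L] [Algebra ℝ L] {f : L → WithTop ℝ}
    (hf : IsPlaceFun f) (r : ℝ) : f (algebraMap ℝ L r) ≠ ⊤ := by
  intro h
  obtain ⟨n, hn⟩ := exists_nat_gt |r|
  set a := algebraMap ℝ L r with ha
  have ha0 : a ≠ 0 := (hf.2.2.2 a h).1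
  have hainv := (hf.2.2.2 a h).2
  have hsq : (n:ℝ)^2 - r^2 ≥ 0 := by
    have : r^2 ≤ (n:ℝ)^2 := sq_le_sq' (by linarith [neg_abs_le r]) (by linarith [le_abs_self r])
    linarith
  have hy : r^2 + Real.sqrt ((n:ℝ)^2 - r^2)^2 = (n:ℝ)^2 := by
    rw [Real.sq_sqrt hsq]; ring
  set y := algebraMap ℝ L (Real.sqrt ((n:ℝ)^2 - r^2)) with hyd
  have hL : a^2 + y^2 = (n:L)^2 := by
    have := congrArg (algebraMap ℝ L) hy
    simpa using this
  have hinvm : a⁻¹ ∈ placeRing hf := by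
    rw [mem_placeRing, hainv]; exact WithTop.zero_ne_top
  have hres0 : placeRes hf ⟨a⁻¹, hinvm⟩ = 0 := by
    apply WithTop.coe_injective
    rw [coe_placeRes]; exact hainv
  by_cases hc : y * a⁻¹ ∈ placeRing hf
  · have key : (1 : placeRing hf) + ⟨y * a⁻¹, hc⟩^2 = (n:placeRing hf)^2 * ⟨a⁻¹, hinvm⟩^2 := by
      apply Subtype.ext
      push_cast
      rw [← hL]; field_simp
    have := congrArg (placeRes hf) key
    simp only [map_add, map_mul, map_pow, map_one, hres0] at this
    nlinarith [sq_nonneg (placeRes hf ⟨y * a⁻¹, hc⟩)]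
  · have htop : f (y * a⁻¹) = ⊤ := by
      by_contra h'
      exact hc h'
    obtain ⟨hne, hz⟩ := hf.2.2.2 _ htop
    have hm : (y * a⁻¹)⁻¹ ∈ placeRing hf := by
      rw [mem_placeRing, hz]; exact WithTop.zero_ne_top
    have hr0 : placeRes hf ⟨(y * a⁻¹)⁻¹, hm⟩ = 0 := by
      apply WithTop.coe_injective
      rw [coe_placeRes]; exact hz
    have hy0 : y ≠ 0 := left_ne_zero_of_mul hne
    have key : (1 : placeRing hf) + ⟨(y * a⁻¹)⁻¹, hm⟩^2
        = (n:placeRing hf)^2 * ⟨a⁻¹, hinvm⟩^2 * ⟨(y * a⁻¹)⁻¹, hm⟩^2:= by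
      apply Subtype.ext
      push_cast
      rw [← hL]; field_simp
      ring
    have := congrArg (placeRes hf) key
    simp only [map_add, map_mul, map_pow, map_one, hres0, hr0] at this
    norm_num at this

theorem place_real {L : Type*} [Field L] [Algebra ℝ L] {f : L → WithTop ℝ}
    (hf : IsPlaceFun f) (r : ℝ) : f (algebraMap ℝ L r) = (r : WithTop ℝ) := by
  let g : ℝ →+* placeRing hf :=
    (algebraMap ℝ L).codRestrict (placeRing hf) (fun r => place_real_finite hf r)
  have h : (placeRes hf).comp g = RingHom.id ℝ := Subsingleton.elim _ _
  have h2 := congrArg (fun k : ℝ →+* ℝ => k r) h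
  have h3 := coe_placeRes hf (g r)
  have h4 : placeRes hf (g r) = r := h2
  rw [h4] at h3
  exact h3.symm

theorem placeComp_isPlace {L K : Type*} [Field L] [Field K] {z : K → WithTop ℝ}
    {f : L → WithTop K} (hz : IsPlaceFun z) (hf : IsPlaceFun f) :
    IsPlaceFun (placeComp z f) := by
  have ht : ∀ x, f x = ⊤ → placeComp z f x = ⊤ := by
    intro x hx; simp [placeComp, hx]
  have hc : ∀ x (y : K), f x = y → placeComp z f x = z y := by
    intro x y hx; simp [placeComp, hx]
  have hfin : ∀ x, placeComp z f x ≠ ⊤ → ∃ y : K, f x = y := by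
    intro x hx
    have : f x ≠ ⊤ := fun h => hx (ht x h)
    obtain ⟨r, hr⟩ := WithTop.ne_top_iff_exists.1 this
    exact ⟨r, hr.symm⟩
  refine ⟨?_, ?_, ?_, ?_⟩
  · rw [hc 1 1 hf.1, hz.1]
  · intro x y hx hy
    obtain ⟨a, ha⟩ := hfin x hx
    obtain ⟨b, hb⟩ := hfin y hy
    have := hf.2.1 x y (by simp [ha]) (by simp [hb])
    rw [ha, hb, ← WithTop.coe_add] at this
    rw [hc _ _ ha] at hx ⊢
    rw [hc _ _ hb] at hy ⊢
    rw [hc _ _ this]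
    exact hz.2.1 _ _ hx hy
  · intro x y hx hy
    obtain ⟨a, ha⟩ := hfin x hx
    obtain ⟨b, hb⟩ := hfin y hy
    have := hf.2.2.1 x y (by simp [ha]) (by simp [hb])
    rw [ha, hb, ← WithTop.coe_mul] at this
    rw [hc _ _ ha] at hx ⊢
    rw [hc _ _ hb] at hy ⊢
    rw [hc _ _ this]
    exact hz.2.2.1 _ _ hx hy
  · intro x hx
    by_cases h : f x = ⊤
    · obtain ⟨h0, h1⟩ := hf.2.2.2 x h
      exact ⟨h0, by rw [hc _ 0 h1, place_zero hz]⟩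
    · obtain ⟨a, ha⟩ := WithTop.ne_top_iff_exists.1 h
      rw [hc _ _ ha.symm] at hx
      obtain ⟨h0, h1⟩ := hz.2.2.2 _ hx
      have hx0 : x ≠ 0 := by
        rintro rfl
        rw [place_zero hf] at ha
        exact h0 (by exact_mod_cast ha)
      refine ⟨hx0, ?_⟩
      have hi : f x⁻¹ ≠ ⊤ := by
        intro hi
        have := (hf.2.2.2 _ hi).2
        rw [inv_inv, ← ha] at this
        exact h0 (by exact_mod_cast this)
      obtain ⟨b, hb⟩ := WithTop.ne_top_iff_exists.1 hi
      have := hf.2.2.1 x x⁻¹ h hi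
      rw [mul_inv_cancel₀ hx0, hf.1, ← ha, ← hb, ← WithTop.coe_mul] at this
      have hab : a * b = 1 := by exact_mod_cast this.symm
      rw [hc _ _ hb.symm, ← h1, eq_inv_of_mul_eq_one_right hab]

/-- Place on a field from a local-type datum. -/
theorem exists_place {R F K : Type*} [CommRing R] [Field F] [Field K] (i : R →+* F)
    (p : R →+* K) (hker : ∀ x, i x = 0 → p x = 0)
    (h : ∀ x : F, (∃ u s, p s ≠ 0 ∧ x * i s = i u) ∨
      (∃ u s, p s ≠ 0 ∧ p u = 0 ∧ x * i u = i s)) :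
    ∃ f : F → WithTop K, IsPlaceFun f ∧ (∀ u, f (i u) = p u) ∧
      ∀ x u s, p s ≠ 0 → p u = 0 → x * i u = i s → f x = ⊤ := by
  let P : F → K → Prop := fun x y => ∃ u s, p s ≠ 0 ∧ x * i s = i u ∧ p u = y * p s
  have huniq : ∀ x y y', P x y → P x y' → y = y' := by
    rintro x y y' ⟨u, s, hs, h1, h2⟩ ⟨u', s', hs', h1', h2'⟩
    have : i (u * s' - u' * s) = 0 := by
      rw [map_sub, map_mul, map_mul, ← h1, ← h1']; ring
    have := hker _ this
    rw [map_sub, map_mul, map_mul, h2, h2'] at this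
    have h3 : (y - y') * (p s * p s') = 0 := by linear_combination this
    have := (mul_eq_zero.1 h3).resolve_right (mul_ne_zero hs hs')
    exact sub_eq_zero.1 this
  let f : F → WithTop K := fun x => if hx : ∃ y, P x y then ((hx.choose : K) : WithTop K) else ⊤
  have hfP : ∀ x y, P x y → f x = y := by
    intro x y hxy
    have hx : ∃ y, P x y := ⟨y, hxy⟩
    simp only [f, dif_pos hx]
    rw [huniq _ _ _ hx.choose_spec hxy]
  have hfT : ∀ x, (¬ ∃ y, P x y) → f x = ⊤ := by
    intro x hx
    simp only [f, dif_neg hx]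
  have hne : ∀ x, f x ≠ ⊤ → ∃ y, P x y := by
    intro x hx
    by_contra hcon
    exact hx (hfT x hcon)
  have hi : ∀ s, p s ≠ 0 → i s ≠ 0 := fun s hs h0 => hs (hker s h0)
  refine ⟨f, ⟨?_, ?_, ?_, ?_⟩, ?_, ?_⟩
  · exact hfP 1 1 ⟨1, 1, by simp, by simp, by simp⟩
  · intro x y hx hy
    obtain ⟨a, ha⟩ := hne x hx
    obtain ⟨b, hb⟩ := hne y hy
    rw [hfP _ _ ha, hfP _ _ hb, ← WithTop.coe_add]
    apply hfP
    obtain ⟨u, s, hs, h1, h2⟩ := ha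
    obtain ⟨u', s', hs', h1', h2'⟩ := hb
    refine ⟨u * s' + u' * s, s * s', by simp [hs, hs'], ?_, ?_⟩
    · simp only [map_mul, map_add, ← h1, ← h1']; ring
    · simp only [map_mul, map_add, h2, h2']; ring
  · intro x y hx hy
    obtain ⟨a, ha⟩ := hne x hx
    obtain ⟨b, hb⟩ := hne y hy
    rw [hfP _ _ ha, hfP _ _ hb, ← WithTop.coe_mul]
    apply hfP
    obtain ⟨u, s, hs, h1, h2⟩ := ha
    obtain ⟨u', s', hs', h1', h2'⟩ := hb
    refine ⟨u * u', s * s', by simp [hs, hs'], ?_, ?_⟩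
    · simp only [map_mul, ← h1, ← h1']; ring
    · simp only [map_mul, h2, h2']; ring
  · intro x hx
    rcases h x with ⟨u, s, hs, h1⟩ | ⟨u, s, hs, hu, h1⟩
    · have := hfP x (p u / p s) ⟨u, s, hs, h1, by field_simp⟩
      rw [this] at hx
      exact absurd hx WithTop.coe_ne_top
    · have hx0 : x ≠ 0 := by
        rintro rfl
        rw [zero_mul] at h1
        exact hi s hs h1.symm
      refine ⟨hx0, ?_⟩
      exact hfP _ 0 ⟨u, s, hs, by rw [← h1]; field_simp, by simp [hu]⟩
  · intro u
    exact hfP _ _ ⟨u, 1, by simp, by simp, by simp⟩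
  · intro x u s hs hu h1
    apply hfT
    rintro ⟨y, u', s', hs', h1', h2'⟩
    have : i (s * s' - u' * u) = 0 := by
      rw [map_sub, map_mul, map_mul, ← h1, ← h1']; ring
    have := hker _ this
    rw [map_sub, map_mul, map_mul, hu] at this
    have h3 : p s * p s' = 0 := by linear_combination this
    exact mul_ne_zero hs hs' h3


open TensorProduct in
theorem gauss_place {A B F : Type*} [Field A] [Field B] [Field F] [Algebra ℝ A] [Algebra ℝ B]
    [Algebra ℝ F] (j1 : A →ₐ[ℝ] F) (j2 : B →ₐ[ℝ] F)
    (hinj : Function.Injective (Algebra.TensorProduct.productMap j1 j2))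
    (hfrac : ∀ x : F, ∃ t t', x = Algebra.TensorProduct.productMap j1 j2 t /
      Algebra.TensorProduct.productMap j1 j2 t')
    (f : A → WithTop ℝ) (hf : IsPlaceFun f) :
    ∃ g : F → WithTop B, IsPlaceFun g ∧ (∀ b, g (j2 b) = b) ∧
      (∀ a, f a = ⊤ → g (j1 a) = ⊤) ∧
      ∀ a (r : ℝ), f a = r → g (j1 a) = ((algebraMap ℝ B r : B) : WithTop B) := by
  let O : Subalgebra ℝ A :=
    { (placeRing hf).toSubring with
      algebraMap_mem' := fun r => place_real_finite hf r }
  have hO : ∀ x, x ∈ O ↔ f x ≠ ⊤ := fun x => Iff.rfl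
  let psi : O →ₐ[ℝ] ℝ :=
    { toRingHom := (placeRes hf : placeRing hf →+* ℝ)
      commutes' := by
        intro r
        apply WithTop.coe_injective
        exact (coe_placeRes hf _).trans (place_real hf r) }
  have hpsi : ∀ x : O, ((psi x : ℝ) : WithTop ℝ) = f x.1 := fun x => coe_placeRes hf x
  let i : O ⊗[ℝ] B →ₐ[ℝ] F := Algebra.TensorProduct.productMap (j1.comp O.val) j2
  let p : O ⊗[ℝ] B →ₐ[ℝ] B :=
    Algebra.TensorProduct.productMap ((Algebra.ofId ℝ B).comp psi) (AlgHom.id ℝ B)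
  have hi : ∀ (a : O) b, i (a ⊗ₜ b) = j1 a.1 * j2 b := fun a b => rfl
  have hp : ∀ (a : O) b, p (a ⊗ₜ b) = algebraMap ℝ B (psi a) * b := fun a b => rfl
  have hiinj : Function.Injective i := by
    have h1 : Function.Injective (LinearMap.rTensor B O.val.toLinearMap) :=
      Module.Flat.rTensor_preserves_injective_linearMap _ Subtype.val_injective
    have h2 : ∀ t, i t = Algebra.TensorProduct.productMap j1 j2
        (LinearMap.rTensor B O.val.toLinearMap t) := by
      intro t
      induction t with
      | zero => simp
      | tmul a b => simp [hi]
      | add x y hx hy => rw [map_add, map_add, map_add, hx, hy]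
    intro x y hxy
    rw [h2, h2] at hxy
    exact h1 (hinj hxy)
  have hnorm : ∀ t : A ⊗[ℝ] B, t ≠ 0 → ∃ a : A, a ≠ 0 ∧ ∃ u, p u ≠ 0 ∧
      Algebra.TensorProduct.productMap j1 j2 t = j1 a * i u := by
    intro t ht
    let bs := Module.Basis.ofVectorSpace ℝ B
    obtain ⟨c, hc⟩ := TensorProduct.eq_repr_basis_right bs t
    have hne : c.support.Nonempty := by
      rw [Finset.nonempty_iff_ne_empty]
      intro h
      apply ht
      rw [← hc, Finsupp.sum, h, Finset.sum_empty]
    obtain ⟨j, hj, hmax⟩ := Finset.exists_max_image c.support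
      (fun k => (placeRing hf).valuation (c k)) hne
    have hcj : c j ≠ 0 := Finsupp.mem_support_iff.1 hj
    have hmem : ∀ k, c k / c j ∈ O := by
      intro k
      by_cases hk : k ∈ c.support
      · obtain ⟨a, ha⟩ := ((placeRing hf).valuation_le_iff _ _).1 (hmax k hk)
        have : c k / c j = a := by rw [← ha]; field_simp
        rw [this]
        exact a.2
      · rw [Finsupp.notMem_support_iff.1 hk, zero_div]
        exact O.zero_mem
    refine ⟨c j, hcj, ∑ k ∈ c.support, (⟨c k / c j, hmem k⟩ : O) ⊗ₜ bs k, ?_, ?_⟩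
    · rw [map_sum]
      intro h0
      have h1 : ∑ k ∈ c.support, psi ⟨c k / c j, hmem k⟩ • bs k = 0 := by
        rw [← h0]
        refine Finset.sum_congr rfl fun k _ => ?_
        rw [hp, Algebra.smul_def]
      have h2 := linearIndependent_iff'.1 bs.linearIndependent _ _ h1 j hj
      have h3 : (⟨c j / c j, hmem j⟩ : O) = 1 := Subtype.ext (div_self hcj)
      rw [h3, map_one] at h2
      exact one_ne_zero h2
    · rw [← hc, Finsupp.sum, map_sum, map_sum, Finset.mul_sum]
      refine Finset.sum_congr rfl fun k _ => ?_
      rw [hi, Algebra.TensorProduct.productMap_apply_tmul, ← mul_assoc, ← map_mul]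
      congr 2
      change c k = c j * (c k / c j)
      field_simp
  have hker : ∀ x, i x = 0 → p x = 0 := by
    intro x hx
    have : x = 0 := hiinj (by rw [hx, map_zero])
    rw [this, map_zero]
  have hi0 : ∀ s, p s ≠ 0 → i s ≠ 0 := fun s hs h0 => hs (hker s h0)
  have htop : ∀ a, f a = ⊤ → ∃ h : a⁻¹ ∈ O, psi ⟨a⁻¹, h⟩ = 0 ∧ a ≠ 0 := by
    intro a ha
    obtain ⟨h0, h1⟩ := hf.2.2.2 a ha
    have h : a⁻¹ ∈ O := by rw [hO, h1]; exact WithTop.zero_ne_top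
    refine ⟨h, ?_, h0⟩
    apply WithTop.coe_injective
    rw [hpsi]; exact h1
  have hcases : ∀ x : F, (∃ u s, p s ≠ 0 ∧ x * i s = i u) ∨
      (∃ u s, p s ≠ 0 ∧ p u = 0 ∧ x * i u = i s) := by
    intro x
    by_cases hx : x = 0
    · left
      exact ⟨0, 1, by simp, by simp [hx]⟩
    obtain ⟨t, t', htt⟩ := hfrac x
    have ht : t ≠ 0 := by
      rintro rfl
      exact hx (by rw [htt, map_zero, zero_div])
    have ht' : t' ≠ 0 := by
      rintro rfl
      exact hx (by rw [htt, map_zero, div_zero])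
    obtain ⟨a, ha, u, hu, h1⟩ := hnorm t ht
    obtain ⟨b, hb, s, hs, h2⟩ := hnorm t' ht'
    have hjb : j1 b ≠ 0 := by simpa using hb
    have hja : j1 a ≠ 0 := by simpa using ha
    have hxe : x * i s = j1 (a / b) * i u := by
      have := hi0 s hs
      rw [htt, h1, h2, map_div₀]
      field_simp
    by_cases hab : f (a / b) = ⊤
    · right
      obtain ⟨h, h0, hne⟩ := htop _ hab
      refine ⟨((⟨(a / b)⁻¹, h⟩ : O) ⊗ₜ 1) * s, u, hu, ?_, ?_⟩
      · rw [map_mul, hp, h0]; simp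
      · rw [map_mul, hi, map_one, mul_one, mul_left_comm, hxe, ← mul_assoc, ← map_mul,
          inv_mul_cancel₀ hne, map_one, one_mul]
    · left
      refine ⟨((⟨a / b, hab⟩ : O) ⊗ₜ 1) * u, s, hs, ?_⟩
      rw [hxe, map_mul, hi, map_one, mul_one]
  obtain ⟨g, hg, hg1, hg2⟩ := exists_place i.toRingHom p.toRingHom hker hcases
  refine ⟨g, hg, ?_, ?_, ?_⟩
  · intro b
    have h1 : i ((1 : O) ⊗ₜ b) = j2 b := by rw [hi]; simp
    have h2 : p ((1 : O) ⊗ₜ b) = b := by rw [hp]; simp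
    have h3 : g (i ((1 : O) ⊗ₜ b)) = ((p ((1 : O) ⊗ₜ b) : B) : WithTop B) := hg1 _
    rw [h1, h2] at h3
    exact h3
  · intro a ha
    obtain ⟨h, h0, hne⟩ := htop _ ha
    refine hg2 _ ((⟨a⁻¹, h⟩ : O) ⊗ₜ 1) 1 ?_ ?_ ?_
    · simp
    · change p _ = 0
      rw [hp, h0]; simp
    · change j1 a * i _ = i 1
      rw [hi, map_one, mul_one, map_one, ← map_mul, mul_inv_cancel₀ hne, map_one]
  · intro a r ha
    have hmem : a ∈ O := by rw [hO, ha]; exact WithTop.coe_ne_top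
    have hr : psi ⟨a, hmem⟩ = r := by
      apply WithTop.coe_injective
      rw [hpsi]; exact ha
    have h1 : i ((⟨a, hmem⟩ : O) ⊗ₜ 1) = j1 a := by rw [hi]; simp
    have h2 : p ((⟨a, hmem⟩ : O) ⊗ₜ 1) = algebraMap ℝ B r := by rw [hp, hr, mul_one]
    have h3 : g (i ((⟨a, hmem⟩ : O) ⊗ₜ 1)) = ((p ((⟨a, hmem⟩ : O) ⊗ₜ 1) : B) : WithTop B) :=
      hg1 _
    rw [h1, h2] at h3
    exact h3

end Helpers

/-- let `F₁, F₂` be formally real intermediate fields of an extension `Ω` of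
`ℝ`, linearly disjoint over `ℝ`, and let `F = F₁ ⊔ F₂` be their compositum.  Then the
projection `ρ : M(F) → M(F₁) × M(F₂)` is surjective: any pair of `ℝ`-places `ξ₁` of `F₁`
and `ξ₂` of `F₂` extends to an `ℝ`-place `ξ` of `F` restricting to `ξ₁` and `ξ₂`. -/
theorem product_of_places_surjective {Ω : Type*} [Field Ω] [Algebra ℝ Ω]
    (F1 F2 : IntermediateField ℝ Ω)
    (hdisj : F1.toSubalgebra.LinearDisjoint F2.toSubalgebra)
    (hreal1 : ¬ IsSumSq (-1 : ↥F1)) (hreal2 : ¬ IsSumSq (-1 : ↥F2))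
    (xi1 : ↥F1 → WithTop ℝ) (hxi1 : IsPlaceFun xi1)
    (xi2 : ↥F2 → WithTop ℝ) (hxi2 : IsPlaceFun xi2) :
    ∃ xi : ↥(F1 ⊔ F2) → WithTop ℝ, IsPlaceFun xi ∧
      (∀ x : ↥F1, xi (IntermediateField.inclusion le_sup_left x) = xi1 x) ∧
      (∀ x : ↥F2, xi (IntermediateField.inclusion le_sup_right x) = xi2 x) := by
  let j1 : F1 →ₐ[ℝ] ↥(F1 ⊔ F2) := IntermediateField.inclusion le_sup_left
  let j2 : F2 →ₐ[ℝ] ↥(F1 ⊔ F2) := IntermediateField.inclusion le_sup_right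
  have hval : ∀ t, ((Algebra.TensorProduct.productMap j1 j2 t : ↥(F1 ⊔ F2)) : Ω) =
      Algebra.TensorProduct.productMap F1.val F2.val t := by
    intro t
    induction t with
    | zero => simp
    | tmul a b => rfl
    | add x y hx hy => rw [map_add, map_add, ← hx, ← hy]; rfl
  have hinj : Function.Injective (Algebra.TensorProduct.productMap j1 j2) := by
    intro x y hxy
    apply (Subalgebra.linearDisjoint_iff_injective.1 hdisj)
    have := congrArg (Subtype.val) hxy
    rw [hval, hval] at this
    exact this
  have hfrac : ∀ x : ↥(F1 ⊔ F2), ∃ t t', x = Algebra.TensorProduct.productMap j1 j2 t /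
      Algebra.TensorProduct.productMap j1 j2 t' := by
    intro x
    have hx : (x : Ω) ∈ IntermediateField.adjoin ℝ (F1 ∪ F2 : Set Ω) := x.2
    have hr : Algebra.adjoin ℝ (F1 ∪ F2 : Set Ω) =
        (Algebra.TensorProduct.productMap F1.val F2.val).range := by
      rw [Algebra.TensorProduct.productMap_range, Algebra.adjoin_union,
        IntermediateField.range_val, IntermediateField.range_val]
      congr 1
      · exact Algebra.adjoin_eq F1.toSubalgebra
      · exact Algebra.adjoin_eq F2.toSubalgebra
    obtain ⟨r, hr1, s, hs1, h⟩ := IntermediateField.mem_adjoin_iff_div.1 hx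
    rw [hr] at hr1 hs1
    obtain ⟨t, rfl⟩ := hr1
    obtain ⟨t', rfl⟩ := hs1
    refine ⟨t, t', Subtype.ext ?_⟩
    rw [h]
    change _ = ((Algebra.TensorProduct.productMap j1 j2 t : ↥(F1 ⊔ F2)) : Ω) /
      ((Algebra.TensorProduct.productMap j1 j2 t' : ↥(F1 ⊔ F2)) : Ω)
    rw [hval, hval]
    rfl
  obtain ⟨g, hg, hg2, hgt, hgr⟩ := gauss_place j1 j2 hinj hfrac xi1 hxi1
  refine ⟨placeComp xi2 g, placeComp_isPlace hxi2 hg, ?_, ?_⟩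
  · intro x
    change placeComp xi2 g (j1 x) = xi1 x
    by_cases hx : xi1 x = ⊤
    · simp [placeComp, hgt x hx, hx]
    · obtain ⟨r, hr⟩ := WithTop.ne_top_iff_exists.1 hx
      rw [← hr, placeComp, hgr x r hr.symm, WithTop.recTopCoe_coe]
      exact place_real hxi2 r
  · intro x
    change placeComp xi2 g (j2 x) = xi2 x
    rw [placeComp, hg2 x, WithTop.recTopCoe_coe]
end

section
/- Let $\iota$ be any compatible embedding of $M(\R(x)) \times M(\R(y))$ into $M(\R(x,y))$ (i.e., $\rho \circ \iota = \mathrm{id}$ where $\rho(\xi) = (\xi|_{\R(x)}, \xi|_{\R(y)})$). Then the image of $\iota$ is dense in $M(\R(x,y))$, but every nonempty basic open subset $H'(f_1) \cap \cdots \cap H'(f_m)$ of $M(\R(x,y))$ contains infinitely many places not in the image of $\iota$. Consequently, no compatible embedding $\iota$ is continuous with respect to the product topology. -/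
open Set

noncomputable section

/-- The rational function field `ℝ(x,y)`. -/
abbrev RFF : Type := FractionRing (MvPolynomial (Fin 2) ℝ)

/-- The variables `x` and `y` as elements of `ℝ(x,y)`. -/
def xvar (i : Fin 2) : RFF := algebraMap (MvPolynomial (Fin 2) ℝ) RFF (MvPolynomial.X i)

/-- A real constant as an element of `ℝ(x,y)`. -/
def cst (r : ℝ) : RFF := algebraMap (MvPolynomial (Fin 2) ℝ) RFF (MvPolynomial.C r)

/-- The subfield `ℝ(x)` of `ℝ(x,y)`. -/
def Kx : Subfield RFF := Subfield.closure (insert (xvar 0) (Set.range cst))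

/-- The subfield `ℝ(y)` of `ℝ(x,y)`. -/
def Ky : Subfield RFF := Subfield.closure (insert (xvar 1) (Set.range cst))

section PlaceLemmas
variable {K : Type*} [Field K] {f : K → WithTop ℝ}

lemma pl_one (hf : IsPlaceFun f) : f 1 = ((1 : ℝ) : WithTop ℝ) := hf.1

lemma pl_add (hf : IsPlaceFun f) {x y : K} {r s : ℝ} (hx : f x = r) (hy : f y = s) :
    f (x + y) = ((r + s : ℝ) : WithTop ℝ) := by
  rw [hf.2.1 x y (by simp [hx]) (by simp [hy]), hx, hy, WithTop.coe_add]

lemma pl_mul (hf : IsPlaceFun f) {x y : K} {r s : ℝ} (hx : f x = r) (hy : f y = s) :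
    f (x * y) = ((r * s : ℝ) : WithTop ℝ) := by
  rw [hf.2.2.1 x y (by simp [hx]) (by simp [hy]), hx, hy, WithTop.coe_mul]

lemma pl_top (hf : IsPlaceFun f) {x : K} (hx : f x = ⊤) :
    x ≠ 0 ∧ f x⁻¹ = ((0 : ℝ) : WithTop ℝ) := hf.2.2.2 x hx

lemma pl_ex {x : K} (h : f x ≠ ⊤) : ∃ r : ℝ, f x = r := by
  obtain ⟨r, hr⟩ := WithTop.ne_top_iff_exists.1 h
  exact ⟨r, hr.symm⟩

lemma pl_zero (hf : IsPlaceFun f) : f 0 = ((0 : ℝ) : WithTop ℝ) := by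
  have h0 : f 0 ≠ ⊤ := fun h => (pl_top hf h).1 rfl
  obtain ⟨r, hr⟩ := pl_ex h0
  have h := pl_add hf hr hr
  rw [add_zero, hr] at h
  have : r = r + r := by exact_mod_cast h
  have : r = 0 := by linarith
  rw [hr, this]

lemma pl_sq_fin (hf : IsPlaceFun f) {x : K} (h : f (x * x) ≠ ⊤) : f x ≠ ⊤ := by
  intro ht
  obtain ⟨hx, hi⟩ := pl_top hf ht
  obtain ⟨r, hr⟩ := pl_ex h
  have h1 := pl_mul hf hr (pl_mul hf hi hi)
  have : x * x * (x⁻¹ * x⁻¹) = 1 := by field_simp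
  rw [this, pl_one hf] at h1
  have : (1 : ℝ) = r * (0 * 0) := by exact_mod_cast h1
  norm_num at this

lemma pl_neg_one (hf : IsPlaceFun f) : f (-1) = ((-1 : ℝ) : WithTop ℝ) := by
  have hfin : f (-1) ≠ ⊤ := by
    apply pl_sq_fin hf
    rw [neg_mul_neg, one_mul, pl_one hf]
    exact WithTop.coe_ne_top
  obtain ⟨r, hr⟩ := pl_ex hfin
  have h := pl_add hf hr (pl_one hf)
  rw [neg_add_cancel, pl_zero hf] at h
  have : (0 : ℝ) = r + 1 := by exact_mod_cast h
  rw [hr]; congr 1; linarith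

lemma pl_neg (hf : IsPlaceFun f) {x : K} {r : ℝ} (hx : f x = r) :
    f (-x) = ((-r : ℝ) : WithTop ℝ) := by
  have := pl_mul hf (pl_neg_one hf) hx
  simpa using this

lemma pl_sub (hf : IsPlaceFun f) {x y : K} {r s : ℝ} (hx : f x = r) (hy : f y = s) :
    f (x - y) = ((r - s : ℝ) : WithTop ℝ) := by
  rw [sub_eq_add_neg, sub_eq_add_neg]; exact pl_add hf hx (pl_neg hf hy)

lemma pl_nat (hf : IsPlaceFun f) (n : ℕ) : f n = ((n : ℝ) : WithTop ℝ) := by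
  induction n with
  | zero => simpa using pl_zero hf
  | succ n ih => simpa using pl_add hf ih (pl_one hf)

lemma pl_inv (hf : IsPlaceFun f) {x : K} {r : ℝ} (hx : f x = r) (hr : r ≠ 0) :
    f x⁻¹ = ((r⁻¹ : ℝ) : WithTop ℝ) := by
  have hx0 : x ≠ 0 := by
    rintro rfl
    rw [pl_zero hf] at hx
    exact hr (by exact_mod_cast hx.symm)
  have hfin : f x⁻¹ ≠ ⊤ := by
    intro h
    have h2 := (pl_top hf h).2
    rw [inv_inv, hx] at h2
    exact hr (by exact_mod_cast h2)
  obtain ⟨s, hs⟩ := pl_ex hfin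
  have h := pl_mul hf hx hs
  rw [mul_inv_cancel₀ hx0, pl_one hf] at h
  have : (1 : ℝ) = r * s := by exact_mod_cast h
  rw [hs]; congr 1; field_simp; linarith

lemma pl_div (hf : IsPlaceFun f) {x y : K} {r s : ℝ} (hx : f x = r) (hy : f y = s) (hs : s ≠ 0) :
    f (x / y) = ((r / s : ℝ) : WithTop ℝ) := by
  rw [div_eq_mul_inv, div_eq_mul_inv]; exact pl_mul hf hx (pl_inv hf hy hs)

/-- value zero of a nonzero element: the inverse has value infinity. -/
lemma pl_inv_top (hf : IsPlaceFun f) {x : K} (hx : f x = ((0 : ℝ) : WithTop ℝ)) (h0 : x ≠ 0) :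
    f x⁻¹ = ⊤ := by
  by_contra h
  obtain ⟨s, hs⟩ := pl_ex h
  have h := pl_mul hf hx hs
  rw [mul_inv_cancel₀ h0, pl_one hf] at h
  have : (1 : ℝ) = 0 * s := by exact_mod_cast h
  norm_num at this

lemma pl_div_top (hf : IsPlaceFun f) {x y : K} {r : ℝ} (hx : f x = r) (hr : r ≠ 0)
    (hy : f y = ((0 : ℝ) : WithTop ℝ)) (h0 : y ≠ 0) : f (x / y) = ⊤ := by
  have hx0 : x ≠ 0 := by
    rintro rfl
    rw [pl_zero hf] at hx
    exact hr (by exact_mod_cast hx.symm)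
  have h := pl_div hf hy hx hr
  rw [zero_div] at h
  have := pl_inv_top hf h (div_ne_zero h0 hx0)
  rwa [inv_div] at this

lemma pl_const [Algebra ℝ K] (hf : IsPlaceFun f) (c : ℝ) : f (algebraMap ℝ K c) = c := by
  have key : ∀ s : ℝ, 0 < s → f (algebraMap ℝ K s) ≠ ((0 : ℝ) : WithTop ℝ) := by
    intro s hs h
    obtain ⟨n, hn⟩ := exists_nat_gt (1 / s)
    have hn' : 1 < n * s := by rwa [div_lt_iff₀ hs] at hn
    set t := Real.sqrt (n * s - 1) with ht
    have htt : t * t = n * s - 1 := Real.mul_self_sqrt (by linarith)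
    have h1 := pl_sub hf (pl_mul hf (pl_nat hf n) h) (pl_one hf)
    have h2 : (n : K) * algebraMap ℝ K s - 1 = algebraMap ℝ K t * algebraMap ℝ K t := by
      rw [← map_mul, htt]; simp
    rw [h2] at h1
    obtain ⟨w, hw⟩ := pl_ex (pl_sq_fin hf (x := algebraMap ℝ K t) (by rw [h1]; exact WithTop.coe_ne_top))
    have h3 := pl_mul hf hw hw
    rw [h1] at h3
    have : (n * 0 - 1 : ℝ) = w * w := by exact_mod_cast h3
    nlinarith [mul_self_nonneg w]
  have fin : ∀ s : ℝ, f (algebraMap ℝ K s) ≠ ⊤ := by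
    intro s h
    obtain ⟨h0, h1⟩ := pl_top hf h
    have hs0 : s ≠ 0 := by rintro rfl; simp at h0
    rw [← map_inv₀] at h1
    rcases lt_or_gt_of_ne hs0 with hs | hs
    · have h2 := pl_neg hf h1
      rw [← map_neg, neg_zero] at h2
      exact key (-s⁻¹) (by have := inv_lt_zero.2 hs; linarith) h2
    · exact key s⁻¹ (inv_pos.2 hs) h1
  choose g hg using fun s => pl_ex (fin s)
  let G : ℝ →+* ℝ :=
    { toFun := g
      map_one' := by
        have := hg 1; rw [map_one, pl_one hf] at this; exact_mod_cast this.symm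
      map_zero' := by
        have := hg 0; rw [map_zero, pl_zero hf] at this; exact_mod_cast this.symm
      map_add' := fun a b => by
        have := hg (a + b); rw [map_add, pl_add hf (hg a) (hg b)] at this; exact_mod_cast this.symm
      map_mul' := fun a b => by
        have := hg (a * b); rw [map_mul, pl_mul hf (hg a) (hg b)] at this; exact_mod_cast this.symm }
  have hG : G = RingHom.id ℝ := Subsingleton.elim _ _
  have : g c = c := by
    change G c = c
    rw [hG]; rfl
  rw [hg c, this]

/-- value of a polynomial expression. -/
lemma pl_mv [Algebra ℝ K] (hf : IsPlaceFun f) {σ : Type*} {z : σ → K} {a : σ → ℝ}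
    (hz : ∀ i, f (z i) = a i) (p : MvPolynomial σ ℝ) :
    f (MvPolynomial.aeval z p) = ((MvPolynomial.eval a p : ℝ) : WithTop ℝ) := by
  induction p using MvPolynomial.induction_on with
  | C r => simpa using pl_const hf r
  | add p q hp hq => rw [map_add, map_add]; exact pl_add hf hp hq
  | mul_X p i hp => rw [map_mul, map_mul]; exact pl_mul hf hp (by simpa using hz i)

lemma pl_poly [Algebra ℝ K] (hf : IsPlaceFun f) {z : K} {a : ℝ}
    (hz : f z = a) (p : Polynomial ℝ) :
    f (Polynomial.aeval z p) = ((Polynomial.eval a p : ℝ) : WithTop ℝ) := by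
  induction p using Polynomial.induction_on' with
  | add p q hp hq => rw [map_add, Polynomial.eval_add]; exact pl_add hf hp hq
  | monomial n r =>
    induction n with
    | zero => simpa using pl_const hf r
    | succ n ih =>
      have := pl_mul hf ih hz
      simpa [pow_succ, mul_assoc] using this
end PlaceLemmas

noncomputable section BlowUp
open MvPolynomial

/-- The polynomial ring in two variables. -/
abbrev A2 : Type := MvPolynomial (Fin 2) ℝ

lemma finite_quot {p q : A2} (h : IsRelPrime p q) (hq : q ≠ 0) :
    Module.Finite ℝ (A2 ⧸ Ideal.span {p, q}) := by
  rw [Module.finite_iff_krullDimLE_zero, Ideal.krullDimLE_zero_quotient_iff_forall_minimalPrimes_isMaximal]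
  intro J hJ
  have hJp : J.IsPrime := hJ.1.1
  have hle : Ideal.span {p, q} ≤ J := hJ.1.2
  have hpJ : p ∈ J := hle (Ideal.subset_span (by simp))
  have hqJ : q ∈ J := hle (Ideal.subset_span (by simp))
  obtain ⟨g, hgJ, hg⟩ := Ideal.IsPrime.exists_mem_prime_of_ne_bot hJp
    (fun hb => hq (by simpa [hb] using hqJ))
  have hgp : (Ideal.span {g}).IsPrime := (Ideal.span_singleton_prime hg.ne_zero).2 hg
  have hlt : Ideal.span {g} < J := by
    refine lt_of_le_of_ne ((Ideal.span_singleton_le_iff_mem _).2 hgJ) ?_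
    intro he
    rw [← he, Ideal.mem_span_singleton] at hpJ hqJ
    exact hg.not_unit (h hpJ hqJ)
  have hlt0 : (⊥ : Ideal A2) < Ideal.span {g} := by
    rw [bot_lt_iff_ne_bot, Ne, Ideal.span_singleton_eq_bot]; exact hg.ne_zero
  by_contra hmax
  obtain ⟨M, hM, hJM⟩ := Ideal.exists_le_maximal J hJp.ne_top
  have hJM' : J < M := lt_of_le_of_ne hJM (by rintro rfl; exact hmax hM)
  have hMp := hM.isPrime
  have hbp : (⊥ : Ideal A2).IsPrime := Ideal.isPrime_bot
  let s : LTSeries (PrimeSpectrum A2) :=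
    { length := 3
      toFun := ![⟨⊥, hbp⟩, ⟨Ideal.span {g}, hgp⟩, ⟨J, hJp⟩, ⟨M, hMp⟩]
      step := by
        intro i
        fin_cases i
        · exact hlt0
        · exact hlt
        · exact hJM' }
  have h1 := Order.LTSeries.length_le_krullDim s
  have h2 : ringKrullDim A2 = 2 := by
    rw [MvPolynomial.ringKrullDim_of_isNoetherianRing]
    simp
  change ((3 : ℕ) : WithBot ℕ∞) ≤ ringKrullDim A2 at h1
  rw [h2] at h1
  exact absurd h1 (by decide)

/-- The ideal of the origin. -/
abbrev mm : Ideal A2 := Ideal.span {X 0, X 1}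

/-- any `d` elements are linearly dependent modulo `(p,q) + m^N`, for every `N`. -/
def Dep (d : ℕ) (p q : A2) : Prop :=
  ∀ (N : ℕ) (x : Fin d → A2), ∃ k : Fin d → ℝ, k ≠ 0 ∧
    ∑ i, k i • x i ∈ Ideal.span {p, q} ⊔ mm ^ N

lemma exists_dep {p q : A2} (h : IsRelPrime p q) (hq : q ≠ 0) : ∃ d, Dep d p q := by
  have := finite_quot h hq
  refine ⟨Module.finrank ℝ (A2 ⧸ Ideal.span {p, q}) + 1, fun N x => ?_⟩
  have hnl : ¬ LinearIndependent ℝ (fun i => Ideal.Quotient.mk (Ideal.span {p, q}) (x i)) := by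
    intro hl
    have := hl.fintype_card_le_finrank
    simp at this
  rw [Fintype.not_linearIndependent_iff] at hnl
  obtain ⟨k, hk, i, hi⟩ := hnl
  refine ⟨k, fun h0 => hi (by simp [h0]), Ideal.mem_sup_left ?_⟩
  rw [← Ideal.Quotient.eq_zero_iff_mem, map_sum, ← hk]
  rfl

/-- The blow-up substitution. -/
def sg (c : ℝ) : A2 →ₐ[ℝ] A2 := aeval ![X 0, X 0 * (X 1 + C c)]

@[simp] lemma sg_X0 (c : ℝ) : sg c (X 0) = X 0 := by simp [sg]
@[simp] lemma sg_X1 (c : ℝ) : sg c (X 1) = X 0 * (X 1 + C c) := by simp [sg]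

/-- restriction to the exceptional line. -/
def pr : A2 →ₐ[ℝ] Polynomial ℝ := aeval ![0, Polynomial.X]
@[simp] lemma pr_X0 : pr (X 0) = 0 := by simp [pr]
@[simp] lemma pr_X1 : pr (X 1) = Polynomial.X := by simp [pr]

/-- section of `pr`. -/
def sec : Polynomial ℝ →ₐ[ℝ] A2 := Polynomial.aeval (X 1)

lemma dvd_of_pr {e : A2} (h : pr e = 0) : (X 0 : A2) ∣ e := by
  have key : (Ideal.Quotient.mkₐ ℝ (Ideal.span {(X 0 : A2)})) =
      ((Ideal.Quotient.mkₐ ℝ (Ideal.span {(X 0 : A2)})).comp sec).comp pr := by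
    apply MvPolynomial.algHom_ext
    intro i
    fin_cases i
    · simp [sec, Ideal.Quotient.eq_zero_iff_mem, Ideal.mem_span_singleton]
    · simp [sec]
  have h1 := DFunLike.congr_fun key e
  rw [AlgHom.comp_apply, h, map_zero] at h1
  rwa [Ideal.Quotient.mkₐ_eq_mk, Ideal.Quotient.eq_zero_iff_mem, Ideal.mem_span_singleton] at h1

lemma pr_sec (r : Polynomial ℝ) : pr (sec r) = r := by
  have : pr.comp sec = AlgHom.id ℝ _ := by
    apply Polynomial.algHom_ext; simp [sec]
  exact DFunLike.congr_fun this r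

lemma pr_sg (c : ℝ) (a : A2) : pr (sg c a) = Polynomial.C (eval 0 a) := by
  have : (pr.comp (sg c)) = (Algebra.ofId ℝ (Polynomial ℝ)).comp (aeval (0 : Fin 2 → ℝ)) := by
    apply MvPolynomial.algHom_ext
    intro i
    fin_cases i <;> simp [sg, pr]
  have := DFunLike.congr_fun this a
  simpa [Algebra.ofId_apply, MvPolynomial.aeval_eq_eval] using this

lemma X0_mem : (X 0 : A2) ∈ mm := Ideal.subset_span (by simp)
lemma X1_mem : (X 1 : A2) ∈ mm := Ideal.subset_span (by simp)

lemma mono_mem {n i j : ℕ} (h : n ≤ i + j) (a : A2) : a * (X 0 ^ i * X 1 ^ j) ∈ mm ^ n := by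
  apply Ideal.mul_mem_left
  apply Ideal.pow_le_pow_right h
  rw [pow_add]
  exact Ideal.mul_mem_mul (Ideal.pow_mem_pow X0_mem _) (Ideal.pow_mem_pow X1_mem _)

lemma rep (n : ℕ) {x : A2} (hx : x ∈ mm ^ n) :
    ∃ a : ℕ → A2, x = ∑ j ∈ Finset.range (n + 1), a j * (X 0 ^ (n - j) * X 1 ^ j) := by
  have key : ∀ n, mm ^ n ≤ Ideal.span ((fun j => (X 0 : A2) ^ (n - j) * X 1 ^ j) ''
      (Finset.range (n + 1) : Set ℕ)) := by
    intro n
    induction n with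
    | zero => simp
    | succ n ih =>
      rw [pow_succ]
      refine (Ideal.mul_mono_left ih).trans ?_
      rw [Ideal.span_mul_span', Ideal.span_le]
      rintro _ ⟨_, ⟨j, hj, rfl⟩, y, hy, rfl⟩
      have hj' : j < n + 1 := by simpa using hj
      apply Ideal.subset_span
      rcases hy with rfl | rfl
      · refine ⟨j, by simp; omega, ?_⟩
        have : n + 1 - j = n - j + 1 := by omega
        simp only [this]; ring
      · refine ⟨j + 1, by simp; omega, ?_⟩
        have : n + 1 - (j + 1) = n - j := by omega
        simp only [this]; ring
  have h := key n hx
  rw [Ideal.span, Submodule.mem_span_image_finset_iff_exists_fun'] at h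
  obtain ⟨a, ha⟩ := h
  exact ⟨a, by simpa using ha.symm⟩

lemma mem_mm_iff {a : A2} : a ∈ mm ↔ eval 0 a = 0 := by
  constructor
  · intro h
    rw [Ideal.mem_span_pair] at h
    obtain ⟨s, t, rfl⟩ := h
    simp
  · intro h
    have : (mm : Ideal A2) = idealOfVars (Fin 2) ℝ := by
      unfold mm idealOfVars
      congr 1
      ext z; simp [Fin.exists_fin_two, eq_comm]
    rw [this]
    have h1 := (mem_pow_idealOfVars_iff' (σ := Fin 2) (R := ℝ) 1 a).2 (by
      intro x hx
      have : x.degree = 0 := by omega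
      rw [Finsupp.degree_eq_zero_iff] at this
      rw [this]
      rw [← h]
      simp [← constantCoeff_eq, MvPolynomial.eval_zero])
    simpa using h1

lemma blow_elem (c : ℝ) (n : ℕ) {x : A2} (hx : x ∈ mm ^ n) :
    ∃ y, sg c x = X 0 ^ n * y ∧ (pr y).natDegree ≤ n ∧ (x ∉ mm ^ (n + 1) → pr y ≠ 0) := by
  obtain ⟨a, rfl⟩ := rep n hx
  set R : Polynomial ℝ := ∑ j ∈ Finset.range (n + 1), Polynomial.C (eval 0 (a j)) * Polynomial.X ^ j
    with hR
  have hpr : pr (∑ j ∈ Finset.range (n + 1), sg c (a j) * (X 1 + C c) ^ j) =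
      R.comp (Polynomial.X + Polynomial.C c) := by
    rw [map_sum, hR, Polynomial.sum_comp]
    refine Finset.sum_congr rfl fun j _ => ?_
    rw [map_mul, pr_sg, map_pow, map_add, pr_X1]
    have : pr (C c) = Polynomial.C c := by
      have := pr.commutes c
      simpa using this
    simp [this]
  refine ⟨∑ j ∈ Finset.range (n + 1), sg c (a j) * (X 1 + C c) ^ j, ?_, ?_, ?_⟩
  · rw [map_sum, Finset.mul_sum]
    refine Finset.sum_congr rfl fun j hj => ?_
    have hj' : j ≤ n := by simpa [Nat.lt_succ_iff] using hj
    rw [map_mul, map_mul, map_pow, map_pow, sg_X0, sg_X1]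
    obtain ⟨k, rfl⟩ := Nat.exists_eq_add_of_le hj'
    rw [Nat.add_sub_cancel_left, mul_pow]; ring
  · rw [hpr, Polynomial.natDegree_comp, Polynomial.natDegree_X_add_C, mul_one]
    refine Polynomial.natDegree_sum_le_of_forall_le _ _ fun j hj => ?_
    have hj' : j ≤ n := by simpa [Nat.lt_succ_iff] using hj
    exact (Polynomial.natDegree_C_mul_X_pow_le _ _).trans hj'
  · intro hn h0
    apply hn
    rw [hpr, Polynomial.comp_X_add_C_eq_zero_iff] at h0
    refine Ideal.sum_mem _ fun j hj => ?_
    have hj' : j ≤ n := by simpa [Nat.lt_succ_iff] using hj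
    have hc : eval 0 (a j) = 0 := by
      have h1 := congrArg (fun r => Polynomial.coeff r j) h0
      simp only [hR, Polynomial.finsetSum_coeff, Polynomial.coeff_C_mul_X_pow] at h1
      simpa [Finset.sum_ite_eq, Nat.lt_succ_iff.2 hj', hj'] using h1
    have := mem_mm_iff.2 hc
    rw [pow_succ']
    refine Ideal.mul_mem_mul this ?_
    have := mono_mem (n := n) (i := n - j) (j := j) (by omega) 1
    simpa using this

lemma sec_shift (c : ℝ) (n N : ℕ) {r : Polynomial ℝ} (hr : r.natDegree ≤ n) :
    ∃ x ∈ mm ^ n, X 0 ^ (n + N) * sec r = sg c x := by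
  set R := r.comp (Polynomial.X - Polynomial.C c) with hR
  have hRd : R.natDegree ≤ n := by
    rw [hR, Polynomial.natDegree_comp, Polynomial.natDegree_X_sub_C, mul_one]; exact hr
  have hrR : r = R.comp (Polynomial.X + Polynomial.C c) := by
    rw [hR, Polynomial.comp_assoc]; simp
  refine ⟨∑ j ∈ Finset.range (n + 1), C (R.coeff j) * (X 0 ^ (n + N - j) * X 1 ^ j), ?_, ?_⟩
  · refine Ideal.sum_mem _ fun j hj => ?_
    have hj' : j ≤ n := by simpa [Nat.lt_succ_iff] using hj
    exact mono_mem (by omega) _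
  · have h1 : sec r = ∑ j ∈ Finset.range (n + 1), C (R.coeff j) * (X 1 + C c) ^ j := by
      conv_lhs => rw [hrR]
      rw [sec, Polynomial.aeval_comp, Polynomial.aeval_eq_sum_range' (Nat.lt_succ_of_le hRd)]
      refine Finset.sum_congr rfl fun j hj => ?_
      simp [MvPolynomial.smul_eq_C_mul]
    rw [h1, map_sum, Finset.mul_sum]
    refine Finset.sum_congr rfl fun j hj => ?_
    have hj' : j ≤ n := by simpa [Nat.lt_succ_iff] using hj
    have hC : sg c (C (R.coeff j)) = C (R.coeff j) := by
      have := (sg c).commutes (R.coeff j)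
      simpa using this
    rw [map_mul, map_mul, map_pow, map_pow, sg_X0, sg_X1, hC]
    obtain ⟨k, rfl⟩ := Nat.exists_eq_add_of_le hj'
    have : j + k + N - j = k + N := by omega
    rw [this, mul_pow]; ring

lemma lift_elem (c : ℝ) (n : ℕ) {g : A2} (hg : pr g ≠ 0) (hgd : (pr g).natDegree ≤ n) (N : ℕ)
    (y : A2) : ∃ x ∈ mm ^ n, ∃ h e, X 0 ^ n * (y - h * g - X 0 ^ N * e) = sg c x := by
  induction N with
  | zero => exact ⟨0, Ideal.zero_mem _, 0, y, by simp⟩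
  | succ N ih =>
    obtain ⟨x, hx, h, e, he⟩ := ih
    set D := pr e / pr g
    set r := pr e % pr g
    have hdiv : pr g * D + r = pr e := EuclideanDomain.div_add_mod _ _
    have hr : r.natDegree ≤ n :=
      (Polynomial.natDegree_le_natDegree (Polynomial.degree_mod_lt _ hg).le).trans hgd
    obtain ⟨x', hx', hxe⟩ := sec_shift c n N hr
    obtain ⟨e', he'⟩ := dvd_of_pr (e := e - sec D * g - sec r) (by
      rw [map_sub, map_sub, map_mul, pr_sec, pr_sec, ← hdiv]; ring)
    refine ⟨x + x', Ideal.add_mem _ hx hx', h + X 0 ^ N * sec D, e', ?_⟩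
    rw [map_add, ← he, ← hxe]
    have : e = sec D * g + sec r + X 0 * e' := by rw [← he']; ring
    rw [this]; ring

lemma dep_step {p q : A2} {d n : ℕ} (c : ℝ) (hn : 1 ≤ n) (hp : p ∈ mm ^ n) (hq : q ∈ mm ^ n)
    (hpq : ¬ (p ∈ mm ^ (n + 1) ∧ q ∈ mm ^ (n + 1))) (hd : Dep (d + 1) p q) :
    ∃ p' q', sg c p = X 0 ^ n * p' ∧ sg c q = X 0 ^ n * q' ∧ Dep d p' q' := by
  obtain ⟨p', hp', hpd, hpn⟩ := blow_elem c n hp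
  obtain ⟨q', hq', hqd, hqn⟩ := blow_elem c n hq
  refine ⟨p', q', hp', hq', ?_⟩
  obtain ⟨g, hgm, hg, hgd⟩ : ∃ g ∈ Ideal.span {p', q'}, pr g ≠ 0 ∧ (pr g).natDegree ≤ n := by
    by_cases h : p ∈ mm ^ (n + 1)
    · exact ⟨q', Ideal.subset_span (by simp), hqn fun h' => hpq ⟨h, h'⟩, hqd⟩
    · exact ⟨p', Ideal.subset_span (by simp), hpn h, hpd⟩
  intro N y
  choose x hx h e hxe using fun i => lift_elem c n hg hgd N (y i)
  obtain ⟨k, hk, hmem⟩ := hd (N + n) (Fin.cons 1 x)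
  rw [Fin.sum_univ_succ] at hmem
  simp only [Fin.cons_zero, Fin.cons_succ] at hmem
  have hm1 : mm ^ n ≤ mm := Ideal.pow_le_self (by omega)
  have hle : Ideal.span {p, q} ⊔ mm ^ (N + n) ≤ mm := by
    refine sup_le ?_ (Ideal.pow_le_self (by omega))
    rw [Ideal.span_le]
    rintro z (rfl | rfl)
    · exact hm1 hp
    · exact hm1 hq
  have hk0 : k 0 = 0 := by
    have h1 := mem_mm_iff.1 (hle hmem)
    have h2 : ∀ i, eval 0 (x i) = 0 := fun i => mem_mm_iff.1 (hm1 (hx i))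
    rw [map_add, map_sum] at h1
    simpa only [smul_eq_C_mul, map_mul, h2, eval_C, mul_zero, Finset.sum_const_zero, add_zero,
      map_one, mul_one] using h1
  rw [hk0, zero_smul, zero_add] at hmem
  refine ⟨fun i => k i.succ, ?_, ?_⟩
  · intro h0
    apply hk
    funext i
    refine Fin.cases hk0 (fun j => ?_) i
    exact congrFun h0 j
  · obtain ⟨z, hz, w, hw, hzw⟩ := Submodule.mem_sup.1 hmem
    obtain ⟨α, β, rfl⟩ := Ideal.mem_span_pair.1 hz
    obtain ⟨w', hw', -, -⟩ := blow_elem c _ hw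
    have h1 := congrArg (sg c) hzw
    rw [map_add, map_add, map_mul, map_mul, hp', hq', hw', map_sum] at h1
    simp only [map_smul, ← hxe] at h1
    have h2 : X 0 ^ n * ∑ i, k i.succ • (y i - h i * g - X 0 ^ N * e i) =
        X 0 ^ n * (sg c α * p' + sg c β * q' + X 0 ^ N * w') := by
      rw [Finset.mul_sum]
      simp only [mul_smul_comm]
      rw [← h1]; ring
    have h3 := mul_left_cancel₀ (pow_ne_zero _ (X_ne_zero _)) h2
    have h4 : ∑ i, k i.succ • y i = sg c α * p' + sg c β * q' + X 0 ^ N * w'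
        + ((∑ i, k i.succ • h i) * g + X 0 ^ N * ∑ i, k i.succ • e i) := by
      rw [← h3, Finset.sum_mul, Finset.mul_sum, ← Finset.sum_add_distrib, ← Finset.sum_add_distrib]
      refine Finset.sum_congr rfl fun i _ => ?_
      simp only [smul_eq_C_mul]; ring
    rw [h4]
    have hX : ∀ t : A2, X 0 ^ N * t ∈ Ideal.span {p', q'} ⊔ mm ^ N := fun t =>
      Ideal.mem_sup_right (Ideal.mul_mem_right _ _ (Ideal.pow_mem_pow X0_mem _))
    have hpm : p' ∈ Ideal.span {p', q'} := Ideal.subset_span (by simp)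
    have hqm : q' ∈ Ideal.span {p', q'} := Ideal.subset_span (by simp)
    refine Ideal.add_mem _ (Ideal.add_mem _ (Ideal.mem_sup_left ?_) (hX _))
      (Ideal.add_mem _ (Ideal.mem_sup_left (Ideal.mul_mem_left _ _ hgm)) (hX _))
    exact Ideal.add_mem _ (Ideal.mul_mem_left _ _ hpm) (Ideal.mul_mem_left _ _ hqm)

end BlowUp

section Transfer
open MvPolynomial Topology

lemma generic_near {a₀ : Fin 2 → ℝ} {h : A2} (hh : h ≠ 0) {S : Set (Fin 2 → ℝ)} (hS : S ∈ 𝓝 a₀) :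
    ∃ a ∈ S, eval a h ≠ 0 := by
  obtain ⟨δ, hδ, hb⟩ := Metric.mem_nhds_iff.1 hS
  by_contra hcon
  push Not at hcon
  apply hh
  refine funext_set (fun i => Metric.ball (a₀ i) δ) (fun i => ?_) fun x hx => ?_
  · rw [Real.ball_eq_Ioo]; exact Set.Ioo_infinite (by linarith)
  · rw [map_zero]
    apply hcon
    apply hb
    rw [ball_pi _ hδ]
    exact hx

lemma eval_sg (c : ℝ) (a : Fin 2 → ℝ) (x : A2) :
    eval a (sg c x) = eval ![a 0, a 0 * (a 1 + c)] x := by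
  have : (aeval a).comp (sg c) = (aeval ![a 0, a 0 * (a 1 + c)] : A2 →ₐ[ℝ] ℝ) := by
    apply MvPolynomial.algHom_ext
    intro i
    fin_cases i <;> simp
  have := DFunLike.congr_fun this x
  simpa [MvPolynomial.aeval_eq_eval] using this

lemma aeval_sg {K : Type*} [Field K] [Algebra ℝ K] (c : ℝ) (u v : K) (hu : u ≠ 0) (x : A2) :
    aeval ![u, v / u - algebraMap ℝ K c] (sg c x) = aeval ![u, v] x := by
  have : (aeval ![u, v / u - algebraMap ℝ K c]).comp (sg c) = (aeval ![u, v] : A2 →ₐ[ℝ] K) := by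
    apply MvPolynomial.algHom_ext
    intro i
    fin_cases i
    · simp
    · simp [MvPolynomial.aeval_C]; field_simp
  exact DFunLike.congr_fun this x

lemma sg_ne_zero (c : ℝ) {x : A2} (hx : x ≠ 0) : sg c x ≠ 0 := by
  intro h0
  obtain ⟨a, -, ha⟩ := generic_near (a₀ := 0) (mul_ne_zero (X_ne_zero (0 : Fin 2)) hx) Filter.univ_mem
  rw [map_mul, eval_X] at ha
  have h1 := eval_sg c ![a 0, a 1 / a 0 - c] x
  have ha0 : a 0 ≠ 0 := left_ne_zero_of_mul ha
  rw [h0, map_zero] at h1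
  apply right_ne_zero_of_mul ha
  rw [h1]
  congr 1
  congr 1
  funext i
  fin_cases i
  · simp
  · simp; field_simp

/-- swap of the variables. -/
noncomputable def sw : A2 →ₐ[ℝ] A2 := aeval ![X 1, X 0]

lemma sw_sw (x : A2) : sw (sw x) = x := by
  have : sw.comp sw = AlgHom.id ℝ _ := by
    apply MvPolynomial.algHom_ext
    intro i
    fin_cases i <;> simp [sw]
  exact DFunLike.congr_fun this x

lemma aeval_sw {K : Type*} [Field K] [Algebra ℝ K] (u v : K) (x : A2) :
    aeval ![v, u] (sw x) = aeval ![u, v] x := by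
  have : (aeval ![v, u]).comp sw = (aeval ![u, v] : A2 →ₐ[ℝ] K) := by
    apply MvPolynomial.algHom_ext
    intro i
    fin_cases i <;> simp [sw]
  exact DFunLike.congr_fun this x

lemma eval_sw (a : Fin 2 → ℝ) (x : A2) : eval a (sw x) = eval ![a 1, a 0] x := by
  have h := aeval_sw (a 1) (a 0) x
  have ha : a = ![a 0, a 1] := by funext i; fin_cases i <;> rfl
  rw [MvPolynomial.aeval_eq_eval, MvPolynomial.aeval_eq_eval] at h
  conv_lhs => rw [ha]
  exact h

lemma sw_ne_zero {x : A2} (hx : x ≠ 0) : sw x ≠ 0 := fun h => hx (by rw [← sw_sw x, h, map_zero])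

lemma dep_sw {d : ℕ} {p q : A2} (h : Dep d p q) : Dep d (sw p) (sw q) := by
  intro N x
  obtain ⟨k, hk, hm⟩ := h N (fun i => sw (x i))
  refine ⟨k, hk, ?_⟩
  have h1 := Ideal.mem_map_of_mem (sw : A2 →ₐ[ℝ] A2) hm
  rw [Ideal.map_sup, Ideal.map_span, Ideal.map_pow, Ideal.map_span, Set.image_pair, Set.image_pair,
    map_sum] at h1
  simp only [map_smul, sw_sw] at h1
  have : Ideal.span {sw (X 0), sw (X 1)} = mm := by
    simp [sw, mm, Set.pair_comm]
  rwa [this] at h1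

variable {K : Type*} [Field K] [Algebra ℝ K]

/-- The conclusion of the transfer statement. -/
def Concl (r : ℝ) (p q : A2) : Prop :=
  ∀ ε > 0, ∀ h : A2, h ≠ 0 → ∃ a : Fin 2 → ℝ, eval a h ≠ 0 ∧ eval a q ≠ 0 ∧
    |eval a p / eval a q - r| < ε

/-- The transfer statement for given coordinates. -/
def St (f : K → WithTop ℝ) (r : ℝ) (u v : K) (p q : A2) : Prop :=
  aeval ![u, v] q ≠ 0 → f (aeval ![u, v] p / aeval ![u, v] q) = r → Concl r p q

lemma st_chart {f : K → WithTop ℝ} (hf : IsPlaceFun f) {r : ℝ} {d : ℕ}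
    (ih : ∀ (p q : A2) (u v : K), Dep d p q → f u = ((0 : ℝ) : WithTop ℝ) →
      f v = ((0 : ℝ) : WithTop ℝ) → St f r u v p q)
    {p q : A2} {u v : K} (hd : Dep (d + 1) p q) (hu : f u = ((0 : ℝ) : WithTop ℝ))
    (hp0 : eval 0 p = 0) (hq0 : eval 0 q = 0)
    (hu0 : u ≠ 0) {c : ℝ} (hc : f (v / u) = c) : St f r u v p q := by
  intro hq hpq
  have hqne : q ≠ 0 := by rintro rfl; simp at hq
  have hex : ∃ n, ¬ (p ∈ mm ^ (n + 1) ∧ q ∈ mm ^ (n + 1)) := by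
    by_contra hcon
    push Not at hcon
    apply hqne
    have h1 : q ∈ ⨅ i : ℕ, mm ^ i := by
      rw [Ideal.mem_iInf]
      intro i
      exact Ideal.pow_le_pow_right (Nat.le_succ i) (hcon i).2
    have hne : mm ≠ ⊤ := by
      intro ht
      have : (1 : A2) ∈ mm := by rw [ht]; trivial
      rw [mem_mm_iff] at this
      simp at this
    rw [Ideal.iInf_pow_eq_bot_of_isDomain _ hne] at h1
    simpa using h1
  classical
  set n := Nat.find hex with hn
  have hnspec : ¬ (p ∈ mm ^ (n + 1) ∧ q ∈ mm ^ (n + 1)) := Nat.find_spec hex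
  have hn1 : 1 ≤ n := by
    by_contra h
    have h0 : n = 0 := by omega
    rw [h0] at hnspec
    apply hnspec
    rw [zero_add, pow_one]
    exact ⟨mem_mm_iff.2 hp0, mem_mm_iff.2 hq0⟩
  have hmin : p ∈ mm ^ n ∧ q ∈ mm ^ n := by
    have := Nat.find_min hex (m := n - 1) (by omega)
    rw [not_not] at this
    rwa [Nat.sub_add_cancel hn1] at this
  obtain ⟨p', q', hp', hq', hd'⟩ := dep_step c hn1 hmin.1 hmin.2 hnspec hd
  set w := v / u - algebraMap ℝ K c with hw
  have hwf : f w = ((0 : ℝ) : WithTop ℝ) := by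
    have := pl_sub hf hc (pl_const hf c)
    rwa [sub_self] at this
  have e1 : aeval ![u, v] p = u ^ n * aeval ![u, w] p' := by
    rw [← aeval_sg c u v hu0, hp', map_mul, map_pow]; simp [hw]
  have e2 : aeval ![u, v] q = u ^ n * aeval ![u, w] q' := by
    rw [← aeval_sg c u v hu0, hq', map_mul, map_pow]; simp [hw]
  rw [e2] at hq
  rw [e1, e2, mul_div_mul_left _ _ (pow_ne_zero _ hu0)] at hpq
  have hC := ih p' q' u w hd' hu hwf (right_ne_zero_of_mul hq) hpq
  intro ε hε h hh
  obtain ⟨a, ha1, ha2, ha3⟩ := hC ε hε (X 0 * sg c h) (mul_ne_zero (X_ne_zero _) (sg_ne_zero c hh))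
  rw [map_mul, eval_X, eval_sg] at ha1
  have ha0 : a 0 ≠ 0 := left_ne_zero_of_mul ha1
  have f1 : eval ![a 0, a 0 * (a 1 + c)] p = a 0 ^ n * eval a p' := by
    rw [← eval_sg, hp']; simp
  have f2 : eval ![a 0, a 0 * (a 1 + c)] q = a 0 ^ n * eval a q' := by
    rw [← eval_sg, hq']; simp
  refine ⟨_, right_ne_zero_of_mul ha1, ?_, ?_⟩
  · rw [f2]; exact mul_ne_zero (pow_ne_zero _ ha0) ha2
  · rwa [f1, f2, mul_div_mul_left _ _ (pow_ne_zero _ ha0)]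

lemma concl_sw {r : ℝ} {p q : A2} (h : Concl r (sw p) (sw q)) : Concl r p q := by
  intro ε hε k hk
  obtain ⟨a, h1, h2, h3⟩ := h ε hε (sw k) (sw_ne_zero hk)
  rw [eval_sw] at h1 h2
  rw [eval_sw, eval_sw] at h3
  exact ⟨_, h1, h2, h3⟩

lemma st_sw {f : K → WithTop ℝ} {r : ℝ} {p q : A2} {u v : K} (h : St f r v u (sw p) (sw q)) :
    St f r u v p q := by
  intro h1 h2
  apply concl_sw
  apply h
  · rwa [aeval_sw]
  · rwa [aeval_sw, aeval_sw]

lemma st_dep {f : K → WithTop ℝ} (hf : IsPlaceFun f) {r : ℝ} (d : ℕ) :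
    ∀ (p q : A2) (u v : K), Dep d p q → f u = ((0 : ℝ) : WithTop ℝ) →
      f v = ((0 : ℝ) : WithTop ℝ) → St f r u v p q := by
  induction d with
  | zero =>
    intro p q u v hd
    obtain ⟨k, hk, -⟩ := hd 0 Fin.elim0
    exact absurd (Subsingleton.elim _ _) hk
  | succ d ih =>
    intro p q u v hd hu hv
    have hz : ∀ i, f (![u, v] i) = ((0 : Fin 2 → ℝ) i : ℝ) := by
      intro i; fin_cases i
      · simpa using hu
      · simpa using hv
    have hpe := pl_mv hf hz p
    have hqe := pl_mv hf hz q
    by_cases hq0 : eval 0 q = 0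
    · by_cases hp0 : eval 0 p = 0
      · by_cases hchart : u ≠ 0 ∧ f (v / u) ≠ ⊤
        · obtain ⟨c, hc⟩ := pl_ex hchart.2
          exact st_chart hf ih hd hu hp0 hq0 hchart.1 hc
        · intro hq
          have h2 : v ≠ 0 ∧ f (u / v) = ((0 : ℝ) : WithTop ℝ) := by
            by_cases hu0 : u = 0
            · refine ⟨?_, by rw [hu0, zero_div]; exact pl_zero hf⟩
              rintro rfl
              apply hq
              have : (![u, 0] : Fin 2 → K) = (algebraMap ℝ K) ∘ (0 : Fin 2 → ℝ) := by
                funext i; fin_cases i <;> simp [hu0]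
              rw [this, MvPolynomial.aeval_algebraMap_apply, MvPolynomial.aeval_eq_eval]
              change algebraMap ℝ K (eval 0 q) = 0
              rw [hq0, map_zero]
            · have htop : f (v / u) = ⊤ := by
                by_contra h; exact hchart ⟨hu0, h⟩
              have := pl_top hf htop
              rw [inv_div] at this
              exact ⟨fun h => this.1 (by simp [h]), this.2⟩
          refine st_sw ?_ hq
          have e0 : ∀ x : A2, eval 0 (sw x) = eval 0 x := by
            intro x
            rw [eval_sw]
            congr 1; congr 1; funext i; fin_cases i <;> simp
          exact st_chart hf ih (dep_sw hd) hv (by rw [e0, hp0]) (by rw [e0, hq0]) h2.1 h2.2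
      · intro hq hpq
        rw [pl_div_top hf hpe hp0 (by rw [hqe, hq0]) hq] at hpq
        exact absurd hpq (by simp)
    · intro hq hpq
      rw [pl_div hf hpe hqe hq0] at hpq
      have hr : eval 0 p / eval 0 q = r := by exact_mod_cast hpq
      intro ε hε h hh
      have c1 : ContinuousAt (fun a : Fin 2 → ℝ => eval a p / eval a q) 0 :=
        (MvPolynomial.continuous_eval p).continuousAt.div
          (MvPolynomial.continuous_eval q).continuousAt hq0
      have s1 : {a : Fin 2 → ℝ | |eval a p / eval a q - r| < ε} ∈ 𝓝 (0 : Fin 2 → ℝ) := by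
        have := Metric.continuousAt_iff'.1 c1 ε hε
        rw [hr] at this
        simp only [Real.dist_eq] at this
        exact this
      have s2 : {a : Fin 2 → ℝ | eval a q ≠ 0} ∈ 𝓝 (0 : Fin 2 → ℝ) :=
        (MvPolynomial.continuous_eval q).continuousAt.eventually_ne hq0
      obtain ⟨a, ⟨ha1, ha2⟩, ha⟩ := generic_near hh (Filter.inter_mem s1 s2)
      exact ⟨a, ha, ha2, ha1⟩

lemma st_zero {f : K → WithTop ℝ} (hf : IsPlaceFun f) {r : ℝ} (p q : A2) (u v : K)
    (hu : f u = ((0 : ℝ) : WithTop ℝ)) (hv : f v = ((0 : ℝ) : WithTop ℝ)) : St f r u v p q := by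
  intro hq hpq
  have hqne : q ≠ 0 := by rintro rfl; simp at hq
  obtain ⟨p', q', g, hrel, hp', hq'⟩ :=
    UniqueFactorizationMonoid.exists_reduced_factors' p q hqne
  subst hp' hq'
  rw [map_mul] at hq
  rw [map_mul, map_mul, mul_div_mul_left _ _ (left_ne_zero_of_mul hq)] at hpq
  obtain ⟨d, hd⟩ := exists_dep hrel (right_ne_zero_of_mul hqne)
  have hC := st_dep hf d p' q' u v hd hu hv (right_ne_zero_of_mul hq) hpq
  intro ε hε h hh
  obtain ⟨a, h1, h2, h3⟩ := hC ε hε (g * h) (mul_ne_zero (left_ne_zero_of_mul hqne) hh)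
  rw [map_mul] at h1
  refine ⟨a, right_ne_zero_of_mul h1, ?_, ?_⟩
  · rw [map_mul]; exact mul_ne_zero (left_ne_zero_of_mul h1) h2
  · rwa [map_mul, map_mul, mul_div_mul_left _ _ (left_ne_zero_of_mul h1)]

/-- substitution `x ↦ x + c`. -/
noncomputable def sh (c : ℝ) : A2 →ₐ[ℝ] A2 := aeval ![X 0 + C c, X 1]

lemma aeval_sh (c : ℝ) (u v : K) (x : A2) :
    aeval ![u - algebraMap ℝ K c, v] (sh c x) = aeval ![u, v] x := by
  have : (aeval ![u - algebraMap ℝ K c, v]).comp (sh c) = (aeval ![u, v] : A2 →ₐ[ℝ] K) := by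
    apply MvPolynomial.algHom_ext
    intro i
    fin_cases i <;> simp [sh, MvPolynomial.aeval_C]
  exact DFunLike.congr_fun this x

lemma eval_sh (c : ℝ) (a : Fin 2 → ℝ) (x : A2) : eval a (sh c x) = eval ![a 0 + c, a 1] x := by
  have h := aeval_sh (K := ℝ) c (a 0 + c) (a 1) x
  simp only [Algebra.algebraMap_self, RingHom.id_apply, add_sub_cancel_right] at h
  have ha : a = ![a 0, a 1] := by funext i; fin_cases i <;> rfl
  rw [MvPolynomial.aeval_eq_eval, MvPolynomial.aeval_eq_eval] at h
  conv_lhs => rw [ha]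
  exact h

lemma st_sh {f : K → WithTop ℝ} {r : ℝ} {u v : K} (c : ℝ)
    (h : ∀ p q, St f r (u - algebraMap ℝ K c) v p q) (p q : A2) : St f r u v p q := by
  intro h1 h2
  have hC := h (sh c p) (sh c q) (by rwa [aeval_sh]) (by rwa [aeval_sh, aeval_sh])
  intro ε hε k hk
  have hk' : sh c k ≠ 0 := by
    intro h0
    obtain ⟨a, -, ha⟩ := generic_near (a₀ := 0) hk Filter.univ_mem
    apply ha
    have h1 := eval_sh c ![a 0 - c, a 1] k
    rw [h0, map_zero] at h1
    rw [h1]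
    congr 1; congr 1; funext i; fin_cases i <;> simp
  obtain ⟨a, h1, h2, h3⟩ := hC ε hε (sh c k) hk'
  rw [eval_sh] at h1 h2
  rw [eval_sh, eval_sh] at h3
  exact ⟨_, h1, h2, h3⟩

lemma inv_poly (p : A2) : ∃ (D : ℕ) (p' : A2), ∀ (L : Type) [Field L] [Algebra ℝ L] (u v : L),
    u ≠ 0 → aeval ![u, v] p' = u ^ D * aeval ![u⁻¹, v] p := by
  induction p using MvPolynomial.induction_on with
  | C r => exact ⟨0, C r, fun L _ _ u v hu => by simp [MvPolynomial.aeval_C]⟩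
  | add p q hp hq =>
    obtain ⟨D, p', hp⟩ := hp
    obtain ⟨E, q', hq⟩ := hq
    refine ⟨D + E, X 0 ^ E * p' + X 0 ^ D * q', fun L _ _ u v hu => ?_⟩
    rw [map_add, map_mul, map_mul, hp L u v hu, hq L u v hu, map_add]
    simp; ring
  | mul_X p i hp =>
    obtain ⟨D, p', hp⟩ := hp
    fin_cases i
    · refine ⟨D + 1, p', fun L _ _ u v hu => ?_⟩
      rw [hp L u v hu, map_mul]
      simp
      generalize (aeval ![u⁻¹, v]) p = z
      rw [pow_succ]; field_simp
    · refine ⟨D, p' * X 1, fun L _ _ u v hu => ?_⟩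
      rw [map_mul, hp L u v hu, map_mul]
      simp; ring

lemma st_inv {K : Type} [Field K] [Algebra ℝ K] {f : K → WithTop ℝ} {r : ℝ} {u v : K} (hu : u ≠ 0)
    (h : ∀ p q, St f r u⁻¹ v p q) (p q : A2) : St f r u v p q := by
  intro h1 h2
  obtain ⟨D, p', hp⟩ := inv_poly p
  obtain ⟨E, q', hq⟩ := inv_poly q
  have ep : ∀ (L : Type) [Field L] [Algebra ℝ L] (u v : L), u ≠ 0 →
      aeval ![u, v] (X 0 ^ E * p') = u ^ (D + E) * aeval ![u⁻¹, v] p := by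
    intro L _ _ u v hu
    rw [map_mul, hp L u v hu]; simp; ring
  have eq : ∀ (L : Type) [Field L] [Algebra ℝ L] (u v : L), u ≠ 0 →
      aeval ![u, v] (X 0 ^ D * q') = u ^ (D + E) * aeval ![u⁻¹, v] q := by
    intro L _ _ u v hu
    rw [map_mul, hq L u v hu]; simp; ring
  have hui : u⁻¹ ≠ 0 := inv_ne_zero hu
  have hC := h (X 0 ^ E * p') (X 0 ^ D * q')
    (by rw [eq K _ v hui, inv_inv]; exact mul_ne_zero (pow_ne_zero _ hui) h1)
    (by rw [eq K _ v hui, ep K _ v hui, inv_inv, mul_div_mul_left _ _ (pow_ne_zero _ hui)]; exact h2)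
  intro ε hε k hk
  obtain ⟨F, k', hk'⟩ := inv_poly k
  have hk0 : k' ≠ 0 := by
    intro h0
    obtain ⟨a, -, ha⟩ := generic_near (a₀ := 0) (mul_ne_zero (X_ne_zero (0 : Fin 2)) hk)
      Filter.univ_mem
    rw [map_mul, eval_X] at ha
    have ha0 : a 0 ≠ 0 := left_ne_zero_of_mul ha
    have h1 := hk' ℝ (a 0)⁻¹ (a 1) (inv_ne_zero ha0)
    rw [h0, map_zero, inv_inv] at h1
    have h2 := (mul_eq_zero.1 h1.symm).resolve_left (pow_ne_zero _ (inv_ne_zero ha0))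
    apply right_ne_zero_of_mul ha
    rw [MvPolynomial.aeval_eq_eval] at h2
    have hv : a = ![a 0, a 1] := by funext i; fin_cases i <;> rfl
    rw [hv]; exact h2
  obtain ⟨a, h1, h2, h3⟩ := hC ε hε (X 0 * k') (mul_ne_zero (X_ne_zero _) hk0)
  rw [map_mul, eval_X] at h1
  have ha0 : a 0 ≠ 0 := left_ne_zero_of_mul h1
  have hv : a = ![a 0, a 1] := by funext i; fin_cases i <;> rfl
  have gk : eval a k' = (a 0) ^ F * eval ![(a 0)⁻¹, a 1] k := by
    have := hk' ℝ (a 0) (a 1) ha0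
    rw [MvPolynomial.aeval_eq_eval, MvPolynomial.aeval_eq_eval, ← hv] at this
    exact this
  have gp : eval a (X 0 ^ E * p') = (a 0) ^ (D + E) * eval ![(a 0)⁻¹, a 1] p := by
    have := ep ℝ (a 0) (a 1) ha0
    rw [MvPolynomial.aeval_eq_eval, MvPolynomial.aeval_eq_eval, ← hv] at this
    exact this
  have gq : eval a (X 0 ^ D * q') = (a 0) ^ (D + E) * eval ![(a 0)⁻¹, a 1] q := by
    have := eq ℝ (a 0) (a 1) ha0
    rw [MvPolynomial.aeval_eq_eval, MvPolynomial.aeval_eq_eval, ← hv] at this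
    exact this
  rw [gq] at h2
  rw [gp, gq, mul_div_mul_left _ _ (pow_ne_zero _ ha0)] at h3
  rw [gk] at h1
  exact ⟨_, right_ne_zero_of_mul (right_ne_zero_of_mul h1), right_ne_zero_of_mul h2, h3⟩

/-- The transfer principle for one function and one place. -/
lemma st_all {K : Type} [Field K] [Algebra ℝ K] {f : K → WithTop ℝ} (hf : IsPlaceFun f) {r : ℝ}
    (u v : K) (p q : A2) : St f r u v p q := by
  have red : ∀ u v : K, (∀ u', f u' = ((0 : ℝ) : WithTop ℝ) → ∀ p q, St f r u' v p q) →
      ∀ p q, St f r u v p q := by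
    intro u v h
    by_cases hu : f u = ⊤
    · obtain ⟨h0, h1⟩ := pl_top hf hu
      exact st_inv h0 (h _ h1)
    · obtain ⟨c, hc⟩ := pl_ex hu
      refine st_sh c (h _ ?_)
      have := pl_sub hf hc (pl_const hf c)
      rwa [sub_self] at this
  refine red u v (fun u' hu' p q => st_sw ?_) p q
  refine red v u' (fun v' hv' p q => ?_) _ _
  exact st_zero hf p q v' u' hv' hu'

end Transfer

section OrderedPlace
open ArchimedeanClass
open scoped Classical

/-- The standard part place of an ordered field. -/
noncomputable def stPl (F : Type*) [Field F] [LinearOrder F] [IsOrderedRing F] (x : F) : WithTop ℝ :=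
  if 0 ≤ ArchimedeanClass.mk x then ((stdPart x : ℝ) : WithTop ℝ) else ⊤

lemma stPl_place (F : Type*) [Field F] [LinearOrder F] [IsOrderedRing F] : IsPlaceFun (stPl F) := by
  have hfin : ∀ x : F, stPl F x ≠ ⊤ → 0 ≤ ArchimedeanClass.mk x := by
    intro x hx
    by_contra h
    exact hx (by rw [stPl, if_neg h])
  refine ⟨?_, ?_, ?_, ?_⟩
  · rw [stPl, if_pos (by simp), stdPart_one]; rfl
  · intro x y hx hy
    have h1 := hfin x hx
    have h2 := hfin y hy
    have h3 : 0 ≤ ArchimedeanClass.mk (x + y) := le_trans (le_min h1 h2) (min_le_mk_add x y)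
    rw [stPl, if_pos h3, stdPart_add h1 h2, stPl, if_pos h1, stPl, if_pos h2]; rfl
  · intro x y hx hy
    have h1 := hfin x hx
    have h2 := hfin y hy
    have h3 : 0 ≤ ArchimedeanClass.mk (x * y) := by
      rw [mk_mul]; exact add_nonneg h1 h2
    rw [stPl, if_pos h3, stdPart_mul h1 h2, stPl, if_pos h1, stPl, if_pos h2]
    rw [WithTop.coe_mul]
  · intro x hx
    have h1 : ArchimedeanClass.mk x < 0 := by
      by_contra h
      rw [stPl, if_pos (not_lt.1 h)] at hx
      exact WithTop.coe_ne_top hx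
    refine ⟨by rintro rfl; simp at h1, ?_⟩
    have h2 : 0 < ArchimedeanClass.mk x⁻¹ := by
      rw [mk_inv]
      exact LinearOrderedAddCommGroupWithTop.neg_pos.2 (Or.inl h1)
    rw [stPl, if_pos h2.le, stdPart_eq_zero.2 h2.ne']; rfl

lemma stPl_small {F : Type*} [Field F] [LinearOrder F] [IsOrderedRing F] {x : F}
    (h : ∀ n : ℕ, (n : F) * |x| < 1) : stPl F x = ((0 : ℝ) : WithTop ℝ) := by
  have h2 : 0 < ArchimedeanClass.mk x := by
    rw [← mk_one, mk_lt_mk]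
    intro n
    simpa using h n
  rw [stPl, if_pos h2.le, stdPart_eq_zero.2 h2.ne']
end OrderedPlace

section Generic
open MvPolynomial Topology Filter

/-- the filter of generic points near the origin. -/
def genFilter : Filter (Fin 2 → ℝ) where
  sets := {S | ∃ h : A2, h ≠ 0 ∧ ∃ T ∈ 𝓝 (0 : Fin 2 → ℝ), ∀ a ∈ T, eval a h ≠ 0 → a ∈ S}
  univ_sets := ⟨1, one_ne_zero, Set.univ, Filter.univ_mem, fun _ _ _ => trivial⟩
  sets_of_superset := by
    rintro S S' ⟨h, hh, T, hT, H⟩ hS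
    exact ⟨h, hh, T, hT, fun a ha ha' => hS (H a ha ha')⟩
  inter_sets := by
    rintro S S' ⟨h, hh, T, hT, H⟩ ⟨h', hh', T', hT', H'⟩
    refine ⟨h * h', mul_ne_zero hh hh', T ∩ T', Filter.inter_mem hT hT', fun a ha ha' => ?_⟩
    rw [map_mul] at ha'
    exact ⟨H a ha.1 (left_ne_zero_of_mul ha'), H' a ha.2 (right_ne_zero_of_mul ha')⟩

instance genFilter_neBot : genFilter.NeBot := by
  refine ⟨fun hb => ?_⟩
  have : (∅ : Set (Fin 2 → ℝ)) ∈ genFilter := by rw [hb]; exact Filter.mem_bot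
  obtain ⟨h, hh, T, hT, H⟩ := this
  obtain ⟨a, ha, ha'⟩ := generic_near hh hT
  exact H a ha ha'

/-- an ultrafilter of generic points near the origin. -/
noncomputable def genU : Ultrafilter (Fin 2 → ℝ) := Ultrafilter.of genFilter

lemma genU_nhds {T : Set (Fin 2 → ℝ)} (hT : T ∈ 𝓝 (0 : Fin 2 → ℝ)) : T ∈ (genU : Filter (Fin 2 → ℝ)) :=
  Ultrafilter.of_le genFilter ⟨1, one_ne_zero, T, hT, fun _ h _ => h⟩

lemma genU_ne {h : A2} (hh : h ≠ 0) : ∀ᶠ a in (genU : Filter (Fin 2 → ℝ)), eval a h ≠ 0 :=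
  Ultrafilter.of_le genFilter ⟨h, hh, Set.univ, Filter.univ_mem, fun _ _ h => h⟩

/-- the ordered field of germs. -/
abbrev GF : Type := Filter.Germ (genU : Filter (Fin 2 → ℝ)) ℝ

/-- the substitution `x ↦ a + x`, `y ↦ b + x (c + y)`. -/
noncomputable def subst (a b c : ℝ) : A2 →ₐ[ℝ] A2 := aeval ![C a + X 0, C b + X 0 * (C c + X 1)]

lemma eval_subst (a b c : ℝ) (s : Fin 2 → ℝ) (x : A2) :
    eval s (subst a b c x) = eval ![a + s 0, b + s 0 * (c + s 1)] x := by
  have : (aeval s).comp (subst a b c) = (aeval ![a + s 0, b + s 0 * (c + s 1)] : A2 →ₐ[ℝ] ℝ) := by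
    apply MvPolynomial.algHom_ext
    intro i
    fin_cases i <;> simp [subst]
  have := DFunLike.congr_fun this x
  simpa [MvPolynomial.aeval_eq_eval] using this

lemma subst_ne_zero (a b c : ℝ) {x : A2} (hx : x ≠ 0) : subst a b c x ≠ 0 := by
  intro h0
  have hX : (X 0 - C a : A2) ≠ 0 := by
    intro h
    have := congrArg (eval ![a + 1, 0]) h
    simp at this
  obtain ⟨t, -, ht⟩ := generic_near (a₀ := 0) (mul_ne_zero hX hx) Filter.univ_mem
  rw [map_mul] at ht
  have ht0 : t 0 - a ≠ 0 := by simpa using left_ne_zero_of_mul ht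
  have h1 := eval_subst a b c ![t 0 - a, (t 1 - b) / (t 0 - a) - c] x
  rw [h0, map_zero] at h1
  apply right_ne_zero_of_mul ht
  rw [h1]
  congr 2
  funext i
  fin_cases i
  · simp
  · simp; field_simp; ring

/-- polynomials as germs of functions. -/
noncomputable def germHom : A2 →+* GF :=
  (Filter.Germ.coeRingHom (genU : Filter (Fin 2 → ℝ))).comp
    (RingHom.pi fun a : Fin 2 → ℝ => (eval a : A2 →+* ℝ))

lemma germHom_apply (p : A2) :
    germHom p = ((fun a => eval a p : (Fin 2 → ℝ) → ℝ) : GF) := rfl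

lemma germHom_ne {p : A2} (hp : p ≠ 0) : germHom p ≠ 0 := by
  rw [germHom_apply]
  intro h
  have h' : ((fun a => eval a p : (Fin 2 → ℝ) → ℝ) : GF) = ((fun _ => (0 : ℝ) : (Fin 2 → ℝ) → ℝ) : GF) := h
  rw [Filter.Germ.coe_eq] at h'
  obtain ⟨a, h1, h2⟩ := (h'.and (genU_ne hp)).exists
  exact h2 h1

lemma germ_small (i : Fin 2) : stPl GF (germHom (X i)) = ((0 : ℝ) : WithTop ℝ) := by
  apply stPl_small
  intro n
  rw [germHom_apply]
  have hc : Continuous fun a : Fin 2 → ℝ => (n : ℝ) * |a i| := by fun_prop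
  have hT : {a : Fin 2 → ℝ | (n : ℝ) * |a i| < 1} ∈ 𝓝 (0 : Fin 2 → ℝ) :=
    (hc.continuousAt (x := 0)).eventually_lt continuousAt_const (by simp)
  have := genU_nhds hT
  simp only [eval_X]
  rw [Filter.Germ.abs_def]
  change (((fun a => (n : ℝ) * |a i| : (Fin 2 → ℝ) → ℝ)) : GF) < ((fun _ => (1 : ℝ) : (Fin 2 → ℝ) → ℝ) : GF)
  rw [Filter.Germ.coe_lt]
  exact this

/-- embedding of `ℝ(x,y)` into the field of germs. -/
noncomputable def fieldHom (a b c : ℝ) : RFF →+* GF :=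
  IsFractionRing.lift (A := A2) (g := germHom.comp (subst a b c : A2 →+* A2)) (by
    rw [injective_iff_map_eq_zero]
    intro p hp
    by_contra h
    exact germHom_ne (subst_ne_zero a b c h) hp)

lemma fieldHom_poly (a b c : ℝ) (p : A2) :
    fieldHom a b c (algebraMap A2 RFF p) = germHom (subst a b c p) := by
  rw [fieldHom, IsFractionRing.lift_algebraMap]; rfl

lemma place_comp {K L : Type*} [Field K] [Field L] {f : L → WithTop ℝ} (hf : IsPlaceFun f)
    (g : K →+* L) : IsPlaceFun fun x => f (g x) := by
  refine ⟨?_, ?_, ?_, ?_⟩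
  · simp only [map_one]; exact hf.1
  · intro x y; simp only [map_add]; exact hf.2.1 _ _
  · intro x y; simp only [map_mul]; exact hf.2.2.1 _ _
  · intro x hx
    have := hf.2.2.2 _ hx
    refine ⟨fun h => this.1 (by rw [h, map_zero]), ?_⟩
    simp only [map_inv₀]; exact this.2

lemma cst_eq (r : ℝ) : cst r = algebraMap ℝ RFF r := by
  rw [cst, IsScalarTower.algebraMap_apply ℝ A2 RFF]; rfl

lemma aeval_xvar (p : A2) : aeval ![xvar 0, xvar 1] p = algebraMap A2 RFF p := by
  have : (aeval ![xvar 0, xvar 1] : A2 →ₐ[ℝ] RFF) = IsScalarTower.toAlgHom ℝ A2 RFF := by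
    apply MvPolynomial.algHom_ext
    intro i
    fin_cases i <;> simp [xvar]
  exact DFunLike.congr_fun this p

lemma xvar_ne (i : Fin 2) (a : ℝ) : xvar i - cst a ≠ 0 := by
  rw [xvar, cst, ← map_sub]
  intro h
  rw [IsFractionRing.to_map_eq_zero_iff] at h
  have := congrArg (eval fun _ => a + 1) h
  simp at this

/-- the place centered at `(a,b)` in direction `c`. -/
noncomputable def xi (a b c : ℝ) : RPlaces RFF :=
  ⟨fun z => stPl GF (fieldHom a b c z), place_comp (stPl_place GF) _⟩

lemma xi_cst (a b c r : ℝ) : (xi a b c).1 (cst r) = r := by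
  rw [cst_eq]; exact pl_const (xi a b c).2 r

lemma stPl_C (r : ℝ) : stPl GF (germHom (C r)) = r := by
  have h := xi_cst 0 0 0 r
  simp only [xi] at h
  rw [cst, fieldHom_poly] at h
  simpa [subst] using h

lemma xi_x (a b c : ℝ) : (xi a b c).1 (xvar 0) = a := by
  simp only [xi]
  rw [xvar, fieldHom_poly]
  have := pl_add (stPl_place GF) (stPl_C a) (germ_small 0)
  simpa [subst] using this

lemma xi_y (a b c : ℝ) : (xi a b c).1 (xvar 1) = b := by
  simp only [xi]
  rw [xvar, fieldHom_poly]
  have := pl_add (stPl_place GF) (stPl_C b) (pl_mul (stPl_place GF) (germ_small 0)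
    (pl_add (stPl_place GF) (stPl_C c) (germ_small 1)))
  simpa [subst] using this

lemma xi_slope (a b c : ℝ) :
    (xi a b c).1 ((xvar 1 - cst b) / (xvar 0 - cst a)) = c := by
  simp only [xi]
  rw [xvar, xvar, cst, cst, ← map_sub, ← map_sub, map_div₀, fieldHom_poly, fieldHom_poly]
  have e1 : germHom (subst a b c (X 1 - C b)) = germHom (X 0) * germHom (C c + X 1) := by
    rw [← map_mul]; congr 1; simp [subst]
  have e2 : germHom (subst a b c (X 0 - C a)) = germHom (X 0) := by
    congr 1; simp [subst]
  rw [e1, e2, mul_div_cancel_left₀ _ (germHom_ne (X_ne_zero _)), map_add]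
  have := pl_add (stPl_place GF) (stPl_C c) (germ_small 1)
  simpa using this
end Generic

section Restrict
open Polynomial

/-- restriction of a place to a subfield. -/
def resP (F : Subfield RFF) (ξ : RPlaces RFF) : RPlaces F :=
  ⟨fun z => ξ.1 (z : RFF), place_comp ξ.2 F.subtype⟩

/-- the subfield `ℝ(t)`. -/
noncomputable abbrev Kt (t : RFF) : Subfield RFF := Subfield.closure (insert t (Set.range cst))

lemma rep_aux {t z : RFF} (hz : z ∈ Kt t) :
    ∃ p q : ℝ[X], aeval t q ≠ 0 ∧ z = aeval t p / aeval t q := by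
  induction hz using Subfield.closure_induction with
  | mem x hx =>
    rcases hx with rfl | ⟨r, rfl⟩
    · exact ⟨X, 1, by simp, by simp⟩
    · exact ⟨C r, 1, by simp, by simp [cst_eq]⟩
  | one => exact ⟨1, 1, by simp, by simp⟩
  | add x y _ _ hx hy =>
    obtain ⟨p, q, hq, rfl⟩ := hx
    obtain ⟨p', q', hq', rfl⟩ := hy
    refine ⟨p * q' + q * p', q * q', by rw [map_mul]; exact mul_ne_zero hq hq', ?_⟩
    rw [div_add_div _ _ hq hq']; simp
  | neg x _ hx =>
    obtain ⟨p, q, hq, rfl⟩ := hx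
    exact ⟨-p, q, hq, by rw [map_neg, neg_div]⟩
  | inv x _ hx =>
    obtain ⟨p, q, hq, rfl⟩ := hx
    by_cases hp : aeval t p = 0
    · exact ⟨0, 1, by simp, by simp [hp]⟩
    · exact ⟨q, p, hp, by rw [inv_div]⟩
  | mul x y _ _ hx hy =>
    obtain ⟨p, q, hq, rfl⟩ := hx
    obtain ⟨p', q', hq', rfl⟩ := hy
    refine ⟨p * p', q * q', by rw [map_mul]; exact mul_ne_zero hq hq', ?_⟩
    rw [div_mul_div_comm, map_mul, map_mul]

lemma rat_rep {t z : RFF} (hz : z ∈ Kt t) :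
    ∃ p q : ℝ[X], IsCoprime p q ∧ aeval t q ≠ 0 ∧ z = aeval t p / aeval t q := by
  obtain ⟨p, q, hq, rfl⟩ := rep_aux hz
  have hqne : q ≠ 0 := by rintro rfl; simp at hq
  obtain ⟨p', q', g, hrel, hp', hq'⟩ :=
    UniqueFactorizationMonoid.exists_reduced_factors' p q hqne
  subst hp' hq'
  rw [map_mul] at hq
  refine ⟨p', q', hrel.isCoprime, right_ne_zero_of_mul hq, ?_⟩
  rw [map_mul, map_mul, mul_div_mul_left _ _ (left_ne_zero_of_mul hq)]

lemma val_rep {t : RFF} {p q : ℝ[X]} (hc : IsCoprime p q) (hq : aeval t q ≠ 0)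
    {f : RFF → WithTop ℝ} (hf : IsPlaceFun f) {a : ℝ} (ha : f t = a) :
    (q.eval a ≠ 0 ∧ f (aeval t p / aeval t q) = ((p.eval a / q.eval a : ℝ) : WithTop ℝ)) ∨
    (q.eval a = 0 ∧ f (aeval t p / aeval t q) = ⊤) := by
  have hp := pl_poly hf ha p
  have hq' := pl_poly hf ha q
  by_cases h : q.eval a = 0
  · refine Or.inr ⟨h, ?_⟩
    obtain ⟨u, v, huv⟩ := hc
    have hpa : p.eval a ≠ 0 := by
      intro h'
      have := congrArg (Polynomial.eval a) huv
      simp [h, h'] at this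
    rw [h] at hq'
    exact pl_div_top hf hp hpa hq' hq
  · exact Or.inl ⟨h, pl_div hf hp hq' h⟩

lemma val_unique {t z : RFF} (hz : z ∈ Kt t) {f g : RFF → WithTop ℝ} (hf : IsPlaceFun f)
    (hg : IsPlaceFun g) {a : ℝ} (ha : f t = a) (hb : g t = a) : f z = g z := by
  obtain ⟨p, q, hc, hq, rfl⟩ := rat_rep hz
  rcases val_rep hc hq hf ha with ⟨h1, h2⟩ | ⟨h1, h2⟩ <;>
  rcases val_rep hc hq hg hb with ⟨h3, h4⟩ | ⟨h3, h4⟩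
  · rw [h2, h4]
  · exact absurd h3 h1
  · exact absurd h1 h3
  · rw [h2, h4]

lemma res_cont {t : RFF} {F : ℝ → RPlaces RFF} (hF : ∀ a, (F a).1 t = a) :
    Continuous fun a => resP (Kt t) (F a) := by
  apply continuous_generateFrom_iff.2
  rintro _ ⟨z, rfl⟩
  obtain ⟨p, q, hc, hq, hz⟩ := rat_rep z.2
  have : (fun a => resP (Kt t) (F a)) ⁻¹' Hpos z = {a | 0 < p.eval a * q.eval a} := by
    ext a
    change (∃ r : ℝ, 0 < r ∧ (F a).1 (z : RFF) = (r : WithTop ℝ)) ↔ 0 < p.eval a * q.eval a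
    rw [hz]
    rcases val_rep hc hq (F a).2 (hF a) with ⟨h1, h2⟩ | ⟨h1, h2⟩
    · rw [h2]
      have e : p.eval a * q.eval a = p.eval a / q.eval a * (q.eval a) ^ 2 := by field_simp
      have h3 : 0 < (q.eval a) ^ 2 := by positivity
      constructor
      · rintro ⟨r, hr, h⟩
        have : p.eval a / q.eval a = r := by exact_mod_cast h
        rw [e, this]; positivity
      · intro h
        rw [e] at h
        exact ⟨_, pos_of_mul_pos_left h h3.le, rfl⟩
    · rw [h2, h1]
      simp
  rw [this]
  exact isOpen_lt continuous_const (by fun_prop)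
end Restrict

section Main
open MvPolynomial Topology

lemma aeval_xvar' (p : A2) : aeval xvar p = algebraMap A2 RFF p := by
  rw [← aeval_xvar]
  congr 2
  funext i; fin_cases i <;> rfl

lemma point_of {m : ℕ} {f : Fin m → RFF} (h : (⋂ i, Hpos (f i)).Nonempty) :
    ∃ a b : ℝ, ∀ ξ : RPlaces RFF, ξ.1 (xvar 0) = a → ξ.1 (xvar 1) = b → ξ ∈ ⋂ i, Hpos (f i) := by
  obtain ⟨ζ, hζ⟩ := h
  rw [Set.mem_iInter] at hζ
  choose r hr hv using hζ
  obtain ⟨Q, hQ⟩ := IsLocalization.exist_integer_multiples_of_finite (nonZeroDivisors A2) f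
  choose p hp using hQ
  have hQ0 : (Q : A2) ≠ 0 := nonZeroDivisors.ne_zero Q.2
  have hQR : algebraMap A2 RFF Q ≠ 0 := by
    intro h; rw [IsFractionRing.to_map_eq_zero_iff] at h; exact hQ0 h
  have hf : ∀ i, f i = algebraMap A2 RFF (p i) / algebraMap A2 RFF Q := by
    intro i
    rw [hp i, Algebra.smul_def, mul_div_cancel_left₀ _ hQR]
  let P : A2 := ∑ i, (C (r i)⁻¹ * p i - (Q : A2)) ^ 2
  have hval : ζ.1 (aeval ![xvar 0, xvar 1] P / aeval ![xvar 0, xvar 1] ((Q : A2) ^ 2)) =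
      ((0 : ℝ) : WithTop ℝ) := by
    have e : aeval ![xvar 0, xvar 1] P / aeval ![xvar 0, xvar 1] ((Q : A2) ^ 2) =
        ∑ i, (algebraMap ℝ RFF (r i)⁻¹ * f i - 1) ^ 2 := by
      simp only [P, map_sum, Finset.sum_div]
      refine Finset.sum_congr rfl fun i _ => ?_
      rw [map_pow, map_pow, ← div_pow, map_sub, map_mul, aeval_C, aeval_xvar, aeval_xvar, hf i]
      congr 1
      field_simp
    rw [e]
    have : ∀ s : Finset (Fin m), ζ.1 (∑ i ∈ s, (algebraMap ℝ RFF (r i)⁻¹ * f i - 1) ^ 2) =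
        ((0 : ℝ) : WithTop ℝ) := by
      intro s
      induction s using Finset.induction_on with
      | empty => simpa using pl_zero ζ.2
      | insert i s hi ih =>
        rw [Finset.sum_insert hi]
        have h1 := pl_sub ζ.2 (pl_mul ζ.2 (pl_const ζ.2 (r i)⁻¹) (hv i)) (pl_one ζ.2)
        rw [inv_mul_cancel₀ (hr i).ne', sub_self] at h1
        have h2 := pl_add ζ.2 (pl_mul ζ.2 h1 h1) ih
        rw [pow_two, h2]; simp
    exact this _
  obtain ⟨a, -, ha, hlt⟩ := st_all ζ.2 (xvar 0) (xvar 1) P ((Q : A2) ^ 2)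
    (by rw [aeval_xvar, map_pow]; exact pow_ne_zero _ hQR) hval 1 one_pos 1 one_ne_zero
  rw [map_pow] at ha hlt
  have hQa : eval a (Q : A2) ≠ 0 := fun h => ha (by rw [h]; simp)
  have hQ2 : 0 < eval a (Q : A2) ^ 2 := by positivity
  have hP : eval a P < eval a (Q : A2) ^ 2 := by
    rw [sub_zero] at hlt
    have := (abs_lt.1 hlt).2
    rwa [div_lt_one hQ2] at this
  refine ⟨a 0, a 1, fun ξ hx hy => ?_⟩
  rw [Set.mem_iInter]
  intro i
  have hz : ∀ j, ξ.1 (xvar j) = a j := by intro j; fin_cases j; exacts [hx, hy]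
  have h1 := pl_mv ξ.2 hz (p i)
  have h2 := pl_mv ξ.2 hz (Q : A2)
  rw [aeval_xvar'] at h1 h2
  refine ⟨eval a (p i) / eval a (Q : A2), ?_, ?_⟩
  · have h3 : ((r i)⁻¹ * eval a (p i) - eval a (Q : A2)) ^ 2 ≤ eval a P := by
      simp only [P, map_sum]
      have := Finset.single_le_sum (s := Finset.univ)
        (f := fun i => eval a ((C (r i)⁻¹ * p i - (Q : A2)) ^ 2))
        (fun j _ => by simp only [map_pow]; positivity) (Finset.mem_univ i)
      simpa using this
    have h4 : 0 < (r i)⁻¹ * eval a (p i) * eval a (Q : A2) := by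
      nlinarith [sq_nonneg ((r i)⁻¹ * eval a (p i))]
    have h5 : 0 < eval a (p i) * eval a (Q : A2) := by
      rw [mul_assoc] at h4
      exact pos_of_mul_pos_right h4 (inv_pos.2 (hr i)).le
    have e : eval a (p i) / eval a (Q : A2) = eval a (p i) * eval a (Q : A2) / eval a (Q : A2) ^ 2 := by
      field_simp
    rw [e]; positivity
  · rw [hf i]; exact pl_div ξ.2 h1 h2 hQa

lemma open_basis {U : Set (RPlaces RFF)} (hU : IsOpen U) {ζ : RPlaces RFF} (hζ : ζ ∈ U) :
    ∃ (m : ℕ) (f : Fin m → RFF), ζ ∈ (⋂ i, Hpos (f i)) ∧ (⋂ i, Hpos (f i)) ⊆ U := by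
  have hB := TopologicalSpace.isTopologicalBasis_of_subbasis
    (s := {U : Set (RPlaces RFF) | ∃ b, U = Hpos b}) rfl
  obtain ⟨_, ⟨F, ⟨hFfin, hF⟩, rfl⟩, h1, h2⟩ := hB.exists_subset_of_mem_open hζ hU
  have : Fintype F := hFfin.fintype
  choose g hg using fun V : F => hF V.2
  refine ⟨Fintype.card F, fun i => g ((Fintype.equivFin F).symm i), ?_, ?_⟩
  · rw [Set.mem_iInter]
    intro i
    rw [← hg]
    exact h1 _ (Subtype.mem _)
  · refine subset_trans ?_ h2
    intro x hx V hV
    rw [Set.mem_iInter] at hx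
    have := hx (Fintype.equivFin F ⟨V, hV⟩)
    simp only [Equiv.symm_apply_apply] at this
    rwa [← hg] at this

lemma xvar_mem_Kx : xvar 0 ∈ Kx := Subfield.subset_closure (Set.mem_insert _ _)
lemma xvar_mem_Ky : xvar 1 ∈ Ky := Subfield.subset_closure (Set.mem_insert _ _)
end Main

/-- let `ι : M(ℝ(x)) × M(ℝ(y)) → M(ℝ(x,y))` be any compatible embedding,
i.e. `ρ ∘ ι = id` where `ρ` is restriction to the two subfields.  Then the image of `ι`
is dense in `M(ℝ(x,y))`, every nonempty basic open set `H'(f₁) ∩ ⋯ ∩ H'(fₘ)` contains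
infinitely many places outside the image, and `ι` is not continuous with respect to the
product topology. -/
theorem torus_embedding_dense_not_closed_not_continuous
    (iota : RPlaces ↥Kx × RPlaces ↥Ky → RPlaces RFF)
    (hcomp : ∀ p : RPlaces ↥Kx × RPlaces ↥Ky,
      (∀ z : ↥Kx, (iota p).1 (z : RFF) = p.1.1 z) ∧
      (∀ z : ↥Ky, (iota p).1 (z : RFF) = p.2.1 z)) :
    Dense (Set.range iota) ∧
    (∀ (m : ℕ) (f : Fin m → RFF), (⋂ i, Hpos (f i)).Nonempty →
      ((⋂ i, Hpos (f i)) \ Set.range iota).Infinite) ∧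
    ¬ Continuous iota := by
  have ex : ∀ p, (iota p).1 (xvar 0) = p.1.1 ⟨xvar 0, xvar_mem_Kx⟩ :=
    fun p => (hcomp p).1 ⟨xvar 0, xvar_mem_Kx⟩
  have ey : ∀ p, (iota p).1 (xvar 1) = p.2.1 ⟨xvar 1, xvar_mem_Ky⟩ :=
    fun p => (hcomp p).2 ⟨xvar 1, xvar_mem_Ky⟩
  refine ⟨?_, ?_, ?_⟩
  · rw [dense_iff_inter_open]
    rintro U hU ⟨ζ, hζ⟩
    obtain ⟨m, f, h1, h2⟩ := open_basis hU hζ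
    obtain ⟨a, b, hab⟩ := point_of ⟨ζ, h1⟩
    refine ⟨_, h2 (hab _ ?_ ?_), ⟨(resP Kx (xi a b 0), resP Ky (xi a b 0)), rfl⟩⟩
    · rw [ex]; exact xi_x a b 0
    · rw [ey]; exact xi_y a b 0
  · intro m f hne
    obtain ⟨a, b, hab⟩ := point_of hne
    have hinj : Function.Injective (xi a b) := by
      intro c c' h
      have h1 := xi_slope a b c
      rw [h, xi_slope a b c'] at h1
      exact_mod_cast h1.symm
    have hall : Set.range (xi a b) ⊆ ⋂ i, Hpos (f i) := by
      rintro _ ⟨c, rfl⟩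
      exact hab _ (xi_x a b c) (xi_y a b c)
    have hsub : (Set.range (xi a b) ∩ Set.range iota).Subsingleton := by
      rintro _ ⟨⟨c, rfl⟩, ⟨p, hp⟩⟩ _ ⟨⟨c', rfl⟩, ⟨p', hp'⟩⟩
      have hpp : p = p' := by
        refine Prod.ext (Subtype.ext (funext fun z => ?_)) (Subtype.ext (funext fun z => ?_))
        · rw [← (hcomp p).1 z, ← (hcomp p').1 z, hp, hp']
          exact val_unique z.2 (xi a b c).2 (xi a b c').2 (xi_x a b c) (xi_x a b c')
        · rw [← (hcomp p).2 z, ← (hcomp p').2 z, hp, hp']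
          exact val_unique z.2 (xi a b c).2 (xi a b c').2 (xi_y a b c) (xi_y a b c')
      rw [← hp, ← hp', hpp]
    have hinf : (Set.range (xi a b)).Infinite := Set.infinite_range_of_injective hinj
    have := hinf.sdiff hsub.finite
    refine this.mono ?_
    rintro x ⟨hx, hx'⟩
    exact ⟨hall hx, fun h => hx' ⟨hx, h⟩⟩
  · intro hcont
    let g : ℝ × ℝ → RPlaces RFF :=
      fun s => iota (resP Kx (xi s.1 0 0), resP Ky (xi 0 s.2 0))
    have hg : Continuous g := by
      refine hcont.comp (Continuous.prodMk ?_ ?_)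
      · exact (res_cont (t := xvar 0) (F := fun a => xi a 0 0) fun a => xi_x a 0 0).comp continuous_fst
      · exact (res_cont (t := xvar 1) (F := fun a => xi 0 a 0) fun a => xi_y 0 a 0).comp continuous_snd
    have gx : ∀ s, (g s).1 (xvar 0) = s.1 := fun s => by rw [ex]; exact xi_x s.1 0 0
    have gy : ∀ s, (g s).1 (xvar 1) = s.2 := fun s => by rw [ey]; exact xi_y 0 s.2 0
    -- approach the origin along a line
    have key : ∀ (z : RFF) (α β : ℝ), g (0, 0) ∈ Hpos z →
        ∃ ε : ℝ, 0 < ε ∧ g (α * ε, β * ε) ∈ Hpos z := by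
      intro z α β hz
      have hopen : IsOpen (Hpos z) := TopologicalSpace.isOpen_generateFrom_of_mem ⟨z, rfl⟩
      have hl : Continuous fun ε : ℝ => g (α * ε, β * ε) := hg.comp (by fun_prop)
      have h0 : (fun ε : ℝ => g (α * ε, β * ε)) ⁻¹' Hpos z ∈ nhds (0 : ℝ) :=
        (hopen.preimage hl).mem_nhds (by simpa using hz)
      obtain ⟨δ, hδ, hb⟩ := Metric.mem_nhds_iff.1 h0
      refine ⟨δ / 2, by positivity, hb ?_⟩
      rw [Metric.mem_ball, Real.dist_eq, sub_zero, abs_of_pos (by positivity)]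
      linarith
    by_cases htop : (g (0, 0)).1 (xvar 1 / xvar 0) = ⊤
    · have h1 := (pl_top (g (0, 0)).2 htop).2
      rw [inv_div] at h1
      have hm : g (0, 0) ∈ Hpos (1 - xvar 0 / xvar 1 * (xvar 0 / xvar 1)) := by
        refine ⟨_, ?_, pl_sub (g (0, 0)).2 (pl_one (g (0, 0)).2) (pl_mul (g (0, 0)).2 h1 h1)⟩
        norm_num
      obtain ⟨ε, hε, r, hr, hv⟩ := key _ 2 1 hm
      have h2 := pl_div (g (2 * ε, 1 * ε)).2 (gx _) (gy _) (by simpa using hε.ne')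
      rw [pl_sub (g (2 * ε, 1 * ε)).2 (pl_one (g (2 * ε, 1 * ε)).2)
        (pl_mul (g (2 * ε, 1 * ε)).2 h2 h2)] at hv
      have e : (2 * ε) / (1 * ε) = 2 := by field_simp
      simp only [e] at hv
      have : (1 - 2 * 2 : ℝ) = r := by exact_mod_cast hv
      linarith
    · obtain ⟨c, hc⟩ := pl_ex htop
      have h1 := pl_sub (g (0, 0)).2 hc (pl_const (g (0, 0)).2 c)
      rw [sub_self] at h1
      have hm : g (0, 0) ∈ Hpos (1 - (xvar 1 / xvar 0 - algebraMap ℝ RFF c) *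
          (xvar 1 / xvar 0 - algebraMap ℝ RFF c)) := by
        refine ⟨_, ?_, pl_sub (g (0, 0)).2 (pl_one (g (0, 0)).2) (pl_mul (g (0, 0)).2 h1 h1)⟩
        norm_num
      obtain ⟨ε, hε, r, hr, hv⟩ := key _ 1 (c + 2) hm
      have h2 := pl_sub (g (1 * ε, (c + 2) * ε)).2
        (pl_div (g (1 * ε, (c + 2) * ε)).2 (gy _) (gx _) (by simpa using hε.ne'))
        (pl_const (g (1 * ε, (c + 2) * ε)).2 c)
      rw [pl_sub (g (1 * ε, (c + 2) * ε)).2 (pl_one (g (1 * ε, (c + 2) * ε)).2)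
        (pl_mul (g (1 * ε, (c + 2) * ε)).2 h2 h2)] at hv
      have e : ((c + 2) * ε) / (1 * ε) - c = 2 := by field_simp; ring
      simp only [e] at hv
      have : (1 - 2 * 2 : ℝ) = r := by exact_mod_cast hv
      linarith

end
end
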